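/- Let P = ⟨A | R⟩ be a finite presentation of a finitely generated nilpotent group G. Then there exists λ > 0 such that the filling length function of P satisfies FL(n) ≤ λ·n for all n ∈ ℕ; that is, every null-homotopic word w with ℓ(w) ≤ n admits a null-P-sequence S with FL(S) ≤ λ·n. -/

import Mathlib

/-- A word over the alphabet `A`: a list of letters `(a, b)`, where the boolean `b`
records whether the letter is the generator `a` (when `true`) or its formal
inverse `a⁻¹` (when `false`). -/
abbrev Word (A : Type) := List (A × Bool)

/-- The formal inverse of a word. -/
def wordInv {A : Type} (w : Word A) : Word A := (w.map (fun p => (p.1, !p.2))).reverse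

/-- `IsCyclicConj v w` : the word `v` is a cyclic conjugate of the word `w`. -/
def IsCyclicConj {A : Type} (v w : Word A) : Prop := ∃ p q, w = p ++ q ∧ v = q ++ p

/-- A free reduction (deleting a subword `a a⁻¹`, `a` a generator or an inverse of a
generator) or a free expansion (inserting such a subword). -/
def FreeStep {A : Type} (w w' : Word A) : Prop :=
  (∃ (α β : Word A) (x : A × Bool), w = α ++ [x, (x.1, !x.2)] ++ β ∧ w' = α ++ β) ∨
  (∃ (α β : Word A) (x : A × Bool), w = α ++ β ∧ w' = α ++ [x, (x.1, !x.2)] ++ β)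

/-- An application of a relator from `R`: replace `w = αuβ` by `w' = αvβ` where
`u v⁻¹` is a cyclic conjugate of an element of `R` or of the inverse of an element
of `R`. -/
def RelStep {A : Type} (R : Set (Word A)) (w w' : Word A) : Prop :=
  ∃ (α u v β : Word A), w = α ++ u ++ β ∧ w' = α ++ v ++ β ∧
    ∃ r ∈ R, IsCyclicConj (u ++ wordInv v) r ∨ IsCyclicConj (u ++ wordInv v) (wordInv r)

/-- A `P`-sequence for the presentation with relator set `R` : a finite sequence of
words `seq 0, seq 1, …, seq len`, each obtained from the previous one by a free
reduction, a free expansion, or an application of a relator.  The field `isRel`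
records which steps are applications of relators. -/
structure PSeq {A : Type} (R : Set (Word A)) where
  len : ℕ
  seq : Fin (len + 1) → Word A
  isRel : Fin len → Bool
  step : ∀ i : Fin len,
    if isRel i then RelStep R (seq i.castSucc) (seq i.succ)
    else FreeStep (seq i.castSucc) (seq i.succ)

/-- The area of a `P`-sequence: the number of application-of-a-relator moves. -/
def PSeq.area {A : Type} {R : Set (Word A)} (S : PSeq R) : ℕ :=
  (Finset.univ.filter (fun i => S.isRel i = true)).card

/-- The filling length of a `P`-sequence: the maximum of the lengths of its words. -/
def PSeq.fl {A : Type} {R : Set (Word A)} (S : PSeq R) : ℕ :=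
  Finset.univ.sup (fun i => (S.seq i).length)

/-- The height of a `P`-sequence: its number of moves. -/
def PSeq.height {A : Type} {R : Set (Word A)} (S : PSeq R) : ℕ := S.len

/-- `S` is a null-`P`-sequence for the word `w`: it starts at `w` and ends at the
empty word. -/
def IsNullSeq {A : Type} {R : Set (Word A)} (S : PSeq R) (w : Word A) : Prop :=
  S.seq 0 = w ∧ S.seq (Fin.last S.len) = []

open scoped commutatorElement

/-- `IsWeightedCommutator S k x` : `x` is an iterated commutator of weight `k` in elements of
`S`, with inverses allowed at every stage. -/
inductive IsWeightedCommutator {G : Type} [Group G] (S : Set G) : ℕ → G → Prop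
  | of {s : G} : s ∈ S → IsWeightedCommutator S 1 s
  | inv {k : ℕ} {x : G} : IsWeightedCommutator S k x → IsWeightedCommutator S k x⁻¹
  | commutator {i j : ℕ} {x y : G} : IsWeightedCommutator S i x → IsWeightedCommutator S j y →
      IsWeightedCommutator S (i + j) ⁅x, y⁆

/-- `HasCost S ε i κ g` : `g` is a product of iterated commutators of weights at least `i`, of
total cost at most `κ`, where an iterated commutator of weight `j` has cost `ε ^ j`. -/
inductive HasCost {G : Type} [Group G] (S : Set G) (ε : ℝ) (i : ℕ) : ℝ → G → Prop
  | one {κ : ℝ} : 0 ≤ κ → HasCost S ε i κ 1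
  | cons {κ κ' : ℝ} {j : ℕ} {x g : G} : i ≤ j → IsWeightedCommutator S j x →
      HasCost S ε i κ g → κ + ε ^ j ≤ κ' → HasCost S ε i κ' (x * g)

namespace IsWeightedCommutator

variable {G : Type} [Group G] {S : Set G} {i j k : ℕ} {x y : G}

theorem one_le (h : IsWeightedCommutator S k x) : 1 ≤ k := by
  induction h with
  | of _ => exact le_rfl
  | inv _ ih => exact ih
  | commutator _ _ ih₁ ih₂ => omega

theorem mem_lowerCentralSeries (h : IsWeightedCommutator S k x) :
    ∀ d : ℕ, 2 ^ d ≤ k → x ∈ (⊤ : Subgroup G).lowerCentralSeries d := by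
  induction h with
  | of _ =>
    intro d hd
    cases d with
    | zero => simp
    | succ d => have := Nat.one_le_two_pow (n := d); omega
  | inv _ ih => exact fun d hd => inv_mem (ih d hd)
  | @commutator i j x y _ _ ih₁ ih₂ =>
    intro d hd
    cases d with
    | zero => simp
    | succ d =>
      rw [Subgroup.lowerCentralSeries_succ]
      rcases le_total i j with hij | hij
      · rw [Subgroup.commutator_comm]
        exact Subgroup.commutator_mem_commutator (Subgroup.mem_top _) (ih₂ d (by omega))
      · exact Subgroup.commutator_mem_commutator (ih₁ d (by omega)) (Subgroup.mem_top _)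

theorem exists_eq_one [Group.IsNilpotent G] (S : Set G) :
    ∃ c : ℕ, ∀ k x, c ≤ k → IsWeightedCommutator S k x → x = 1 := by
  refine ⟨2 ^ Group.nilpotencyClass G, fun k x hk h => ?_⟩
  have := h.mem_lowerCentralSeries _ hk
  rwa [Subgroup.lowerCentralSeries_nilpotencyClass, Subgroup.mem_bot] at this

theorem finite (hS : S.Finite) (k : ℕ) : {x | IsWeightedCommutator S k x}.Finite := by
  let Y : ℕ → Set G := fun k => S ∪ ⋃ i ∈ Set.Iio k, ⋃ j ∈ Set.Iio k,
    Set.image2 (fun x y => ⁅x, y⁆) {x | IsWeightedCommutator S i x}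
      {x | IsWeightedCommutator S j x}
  have hY : ∀ k x, IsWeightedCommutator S k x → x ∈ Y k ∪ (Y k)⁻¹ := by
    intro k x hx
    induction hx with
    | of hs => exact Or.inl (Or.inl hs)
    | inv _ ih =>
      rcases ih with h | h
      · exact Or.inr (by simpa using h)
      · exact Or.inl h
    | @commutator i j x y hx hy _ _ =>
      refine Or.inl (Or.inr ?_)
      have := hx.one_le
      have := hy.one_le
      simp only [Set.mem_iUnion]
      exact ⟨i, by simp; omega, j, by simp; omega, x, hx, y, hy, rfl⟩
  induction k using Nat.strong_induction_on with
  | _ k ih =>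
    have hfin : (Y k).Finite := hS.union ((Set.finite_Iio k).biUnion fun i hi =>
      (Set.finite_Iio k).biUnion fun j hj => Set.Finite.image2 _ (ih i hi) (ih j hj))
    exact (hfin.union hfin.inv).subset fun x hx => hY k x hx

end IsWeightedCommutator

namespace HasCost

variable {G : Type} [Group G] {S : Set G} {ε κ κ' μ : ℝ} {i j a b : ℕ} {x y u v g h : G}

theorem nonneg (hε : 0 ≤ ε) (hg : HasCost S ε i κ g) : 0 ≤ κ := by
  induction hg with
  | one h => exact h
  | cons _ _ _ h ih => exact (by positivity : (0 : ℝ) ≤ _ + ε ^ _).trans h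

theorem mono (hκ : κ ≤ κ') (hg : HasCost S ε i κ g) : HasCost S ε i κ' g := by
  cases hg with
  | one h => exact one (h.trans hκ)
  | cons hj hx hg h => exact cons hj hx hg (h.trans hκ)

theorem anti (hij : j ≤ i) (hg : HasCost S ε i κ g) : HasCost S ε j κ g := by
  induction hg with
  | one h => exact one h
  | cons hj hx _ h ih => exact cons (hij.trans hj) hx ih h

theorem of_isWeightedCommutator (hij : i ≤ j) (hx : IsWeightedCommutator S j x) :
    HasCost S ε i (ε ^ j) x := by
  simpa using cons hij hx (one le_rfl) (by simp)

theorem mul (hg : HasCost S ε i κ g) (hh : HasCost S ε i κ' h) :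
    HasCost S ε i (κ + κ') (g * h) := by
  induction hg with
  | one h => simpa using hh.mono (by linarith)
  | cons hj hx _ h ih =>
    rw [mul_assoc]
    exact cons hj hx ih (by linarith)

theorem inv (hg : HasCost S ε i κ g) : HasCost S ε i κ g⁻¹ := by
  induction hg with
  | one h => simpa using one h
  | cons hj hx _ h ih =>
    rw [mul_inv_rev]
    exact (ih.mul (of_isWeightedCommutator hj hx.inv)).mono h

theorem pow (hg : HasCost S ε i κ g) (n : ℕ) : HasCost S ε i (n * κ) (g ^ n) := by
  induction n with
  | zero => simpa using one le_rfl
  | succ n ih =>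
    rw [pow_succ]
    exact (ih.mul hg).mono (by push_cast; linarith)

theorem list_prod {L : List G} (hL : ∀ x ∈ L, IsWeightedCommutator S i x) :
    HasCost S ε i (L.length * ε ^ i) L.prod := by
  induction L with
  | nil => simpa using one le_rfl
  | cons x L ih =>
    rw [List.prod_cons]
    refine cons le_rfl (hL x (by simp)) (ih fun y hy => hL y (by simp [hy])) ?_
    rw [List.length_cons]
    push_cast
    linarith

theorem conj_letter (hε : 0 ≤ ε) (hx : IsWeightedCommutator S j x) (hg : HasCost S ε i κ g) :
    HasCost S ε i (κ * (1 + ε ^ j)) (x * g * x⁻¹) := by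
  induction hg with
  | one h => simpa using one (by positivity)
  | @cons κ κ' k y g hk hy _ h ih =>
    have e : x * (y * g) * x⁻¹ = ⁅x, y⁆ * (y * (x * g * x⁻¹)) := by
      simp only [commutatorElement_def]; group
    rw [e]
    refine cons (by omega) (hx.commutator hy) (cons hk hy ih le_rfl) ?_
    have : 0 ≤ ε ^ j := by positivity
    rw [pow_add]
    nlinarith

theorem conj (hε : 0 ≤ ε) (hu : HasCost S ε a κ u) (hg : HasCost S ε i μ g) :
    HasCost S ε i (μ * Real.exp κ) (u * g * u⁻¹) := by
  have hμ := hg.nonneg hε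
  induction hu with
  | @one κ h =>
    have := Real.one_le_exp h
    simpa using hg.mono (by nlinarith)
  | @cons κ κ' k y u hk hy _ h ih =>
    have e : y * u * g * (y * u)⁻¹ = y * (u * g * u⁻¹) * y⁻¹ := by group
    rw [e]
    refine (ih.conj_letter hε hy).mono ?_
    rw [mul_assoc]
    gcongr
    calc Real.exp κ * (1 + ε ^ k) ≤ Real.exp κ * Real.exp (ε ^ k) := by
          gcongr; linarith [Real.add_one_le_exp (ε ^ k)]
      _ ≤ Real.exp κ' := by rw [← Real.exp_add]; gcongr

theorem commutator_letter (hε : 0 ≤ ε) (hx : IsWeightedCommutator S j x)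
    (hv : HasCost S ε b κ v) : HasCost S ε (j + b) (ε ^ j * κ * Real.exp κ) ⁅x, v⁆ := by
  induction hv with
  | one h => simpa using one (by positivity)
  | @cons κ κ' k y v hk hy hv h ih =>
    have e : ⁅x, y * v⁆ = ⁅x, y⁆ * (y * ⁅x, v⁆ * y⁻¹) := by
      simp only [commutatorElement_def]; group
    rw [e]
    refine cons (by omega) (hx.commutator hy) (ih.conj_letter hε hy) ?_
    have hκ := hv.nonneg hε
    have h0 : 0 ≤ ε ^ k := by positivity
    have h1 : Real.exp κ * (1 + ε ^ k) ≤ Real.exp κ' := by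
      calc Real.exp κ * (1 + ε ^ k) ≤ Real.exp κ * Real.exp (ε ^ k) := by
            gcongr; linarith [Real.add_one_le_exp (ε ^ k)]
        _ ≤ Real.exp κ' := by rw [← Real.exp_add]; gcongr
    have h2 : 1 ≤ Real.exp κ' := Real.one_le_exp (by linarith)
    calc ε ^ j * κ * Real.exp κ * (1 + ε ^ k) + ε ^ (j + k)
        = ε ^ j * (κ * (Real.exp κ * (1 + ε ^ k)) + ε ^ k * 1) := by rw [pow_add]; ring
      _ ≤ ε ^ j * (κ * Real.exp κ' + ε ^ k * Real.exp κ') := by gcongr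
      _ = ε ^ j * (κ + ε ^ k) * Real.exp κ' := by ring
      _ ≤ ε ^ j * κ' * Real.exp κ' := by gcongr

theorem commutator (hε : 0 ≤ ε) (hu : HasCost S ε a κ u) (hv : HasCost S ε b μ v) :
    HasCost S ε (a + b) (κ * μ * Real.exp (κ + μ)) ⁅u, v⁆ := by
  have hμ := hv.nonneg hε
  induction hu with
  | one h => simpa using one (by positivity)
  | @cons κ κ' k y u hk hy hu h ih =>
    have e : ⁅y * u, v⁆ = y * ⁅u, v⁆ * y⁻¹ * ⁅y, v⁆ := by
      simp only [commutatorElement_def]; group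
    rw [e]
    refine ((ih.conj_letter hε hy).mul ((hv.commutator_letter hε hy).anti (by omega))).mono ?_
    have hκ := hu.nonneg hε
    have h0 : 0 ≤ ε ^ k := by positivity
    have h1 : Real.exp (κ + μ) * (1 + ε ^ k) ≤ Real.exp (κ' + μ) := by
      calc Real.exp (κ + μ) * (1 + ε ^ k) ≤ Real.exp (κ + μ) * Real.exp (ε ^ k) := by
            gcongr; linarith [Real.add_one_le_exp (ε ^ k)]
        _ ≤ Real.exp (κ' + μ) := by rw [← Real.exp_add]; exact Real.exp_le_exp.2 (by linarith)
    have h2 : Real.exp μ ≤ Real.exp (κ' + μ) := by gcongr; linarith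
    calc κ * μ * Real.exp (κ + μ) * (1 + ε ^ k) + ε ^ k * μ * Real.exp μ
        = κ * μ * (Real.exp (κ + μ) * (1 + ε ^ k)) + ε ^ k * μ * Real.exp μ := by ring
      _ ≤ κ * μ * Real.exp (κ' + μ) + ε ^ k * μ * Real.exp (κ' + μ) := by gcongr
      _ = (κ + ε ^ k) * μ * Real.exp (κ' + μ) := by ring
      _ ≤ κ' * μ * Real.exp (κ' + μ) := by gcongr

theorem exists_collect (hε : 0 ≤ ε) (hg : HasCost S ε j κ g) :
    ∃ v, ∃ L : List G, g = v * L.prod ∧ HasCost S ε (j + 1) (κ * Real.exp κ) v ∧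
      (∀ x ∈ L, IsWeightedCommutator S j x) ∧ L.length * ε ^ j ≤ κ := by
  induction hg with
  | one h => exact ⟨1, [], by simp, one (by positivity), by simp, by simpa using h⟩
  | @cons κ κ' k x g hk hx hg h ih =>
    obtain ⟨v, L, rfl, hv, hL, hlen⟩ := ih
    have hκ := hg.nonneg hε
    have h0 : 0 ≤ ε ^ k := by positivity
    rcases hk.eq_or_lt with rfl | hk
    · refine ⟨x * v * x⁻¹, x :: L, by simp [mul_assoc], (hv.conj_letter hε hx).mono ?_, ?_, ?_⟩
      · calc κ * Real.exp κ * (1 + ε ^ j) ≤ κ * Real.exp κ * Real.exp (ε ^ j) := by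
              gcongr; linarith [Real.add_one_le_exp (ε ^ j)]
          _ = κ * Real.exp (κ + ε ^ j) := by rw [Real.exp_add]; ring
          _ ≤ κ' * Real.exp κ' := by gcongr <;> linarith
      · simpa using ⟨hx, hL⟩
      · rw [List.length_cons]
        push_cast
        linarith
    · refine ⟨x * v, L, by simp [mul_assoc], cons hk hx hv ?_, hL, by linarith⟩
      calc κ * Real.exp κ + ε ^ k ≤ κ * Real.exp κ' + ε ^ k * Real.exp κ' := by
            have : κ ≤ κ' := by linarith
            have : 1 ≤ Real.exp κ' := Real.one_le_exp (by linarith)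
            gcongr
            nlinarith
        _ = (κ + ε ^ k) * Real.exp κ' := by ring
        _ ≤ κ' * Real.exp κ' := by gcongr

theorem exists_perm (hε : 0 ≤ ε) (hj : 1 ≤ j) {L L' : List G} (hp : L.Perm L')
    (hL : ∀ x ∈ L, IsWeightedCommutator S j x) (hκ : L.length * ε ^ j ≤ κ) :
    ∃ v, L.prod = v * L'.prod ∧ HasCost S ε (j + 1) (κ ^ 2 * Real.exp (2 * κ)) v := by
  suffices H : ∀ L' L : List G, L.Perm L' → (∀ x ∈ L, IsWeightedCommutator S j x) →
      L.length * ε ^ j ≤ κ → ∃ v, L.prod = v * L'.prod ∧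
        HasCost S ε (j + 1) (κ * Real.exp κ * ((L'.length * ε ^ j) *
          Real.exp (L'.length * ε ^ j))) v by
    obtain ⟨v, hv, hc⟩ := H L' L hp hL hκ
    refine ⟨v, hv, hc.mono ?_⟩
    rw [← hp.length_eq]
    have h0 : (0 : ℝ) ≤ L.length * ε ^ j := by positivity
    have h1 : 0 ≤ κ := h0.trans hκ
    calc _ ≤ κ * Real.exp κ * (κ * Real.exp κ) := by gcongr
      _ = _ := by rw [two_mul, Real.exp_add]; ring
  intro L'
  induction L' with
  | nil =>
    intro L hp _ _
    obtain rfl := hp.eq_nil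
    exact ⟨1, by simp, one (by simp)⟩
  | cons x L' ih =>
    intro L hp hL hκ
    obtain ⟨L₁, L₂, rfl⟩ := List.append_of_mem (hp.mem_iff.2 (List.mem_cons_self (a := x)))
    have hp' : (L₁ ++ L₂).Perm L' := (List.perm_middle.symm.trans hp).cons_inv
    have hx := hL x (by simp)
    have h0 : 0 ≤ ε ^ j := by positivity
    simp only [List.length_append, List.length_cons] at hκ
    push_cast at hκ
    obtain ⟨v, hv, hc⟩ := ih (L₁ ++ L₂) hp' (fun y hy => hL y (by
      simp only [List.mem_append, List.mem_cons] at hy ⊢; tauto)) (by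
        simp only [List.length_append]; push_cast; linarith)
    have hc₁ : HasCost S ε j (L₁.length * ε ^ j) L₁.prod :=
      list_prod fun y hy => hL y (by simp [hy])
    have hcc := (hc₁.commutator hε (of_isWeightedCommutator le_rfl hx)).anti
      (by omega : j + 1 ≤ j + j)
    refine ⟨⁅L₁.prod, x⁆ * (x * v * x⁻¹), ?_, (hcc.mul (hc.conj_letter hε hx)).mono ?_⟩
    · rw [List.prod_append] at hv
      rw [List.prod_append, List.prod_cons, List.prod_cons]
      calc L₁.prod * (x * L₂.prod) = ⁅L₁.prod, x⁆ * (x * (L₁.prod * L₂.prod)) := by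
            simp only [commutatorElement_def]; group
        _ = _ := by rw [hv]; group
    · have hlen : (L₁.length : ℝ) + L₂.length = L'.length := by
        exact_mod_cast (by simpa using hp'.length_eq)
      have h2 : (0 : ℝ) ≤ L₂.length * ε ^ j := by positivity
      have h1 : (0 : ℝ) ≤ L₁.length * ε ^ j := by positivity
      have hκ0 : 0 ≤ κ := by nlinarith
      rw [List.length_cons]
      push_cast
      set s : ℝ := L'.length * ε ^ j with hs
      have hs0 : 0 ≤ s := by positivity
      set c := ε ^ j
      have e1 : Real.exp s * (1 + c) ≤ Real.exp (s + c) := by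
        rw [Real.exp_add]; gcongr; linarith [Real.add_one_le_exp c]
      have e2 : 1 ≤ Real.exp (s + c) := Real.one_le_exp (by linarith)
      calc L₁.length * c * c * Real.exp (L₁.length * c + c)
            + κ * Real.exp κ * (s * Real.exp s) * (1 + c)
          ≤ κ * c * Real.exp κ + κ * Real.exp κ * (s * Real.exp s) * (1 + c) := by
            gcongr
            · nlinarith
            · nlinarith
        _ = κ * Real.exp κ * (c * 1 + s * (Real.exp s * (1 + c))) := by ring
        _ ≤ κ * Real.exp κ * (c * Real.exp (s + c) + s * Real.exp (s + c)) := by gcongr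
        _ = κ * Real.exp κ * ((L'.length + 1) * c * Real.exp ((L'.length + 1) * c)) := by
            rw [show ((L'.length : ℝ) + 1) * c = s + c by rw [hs]; ring]; ring

theorem exists_split (hε : 0 ≤ ε) (hε₁ : ε ≤ 1) (hg : HasCost S ε i κ g) :
    ∀ t : ℝ, 0 ≤ t → ∃ a b r, g = a * b * r ∧ HasCost S ε i t a ∧ HasCost S ε i 1 b ∧
      HasCost S ε i (max (κ - t) 0) r := by
  induction hg with
  | one h => exact fun t ht => ⟨1, 1, 1, by simp, one ht, one zero_le_one, one (le_max_right _ _)⟩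
  | @cons κ κ' k x g hk hx hg h ih =>
    intro t ht
    have h0 : 0 ≤ ε ^ k := by positivity
    by_cases hkt : ε ^ k ≤ t
    · obtain ⟨a, b, r, rfl, ha, hb, hr⟩ := ih (t - ε ^ k) (by linarith)
      refine ⟨x * a, b, r, by simp [mul_assoc], cons hk hx ha (by linarith), hb, hr.mono ?_⟩
      exact max_le_max (by linarith) le_rfl
    · refine ⟨1, x, g, by simp, one ht, ?_, hg.mono ?_⟩
      · exact (of_isWeightedCommutator hk hx).mono (pow_le_one₀ hε hε₁)
      · exact le_max_of_le_left (by linarith)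

theorem eq_one {c : ℕ} (hc : ∀ k x, c ≤ k → IsWeightedCommutator S k x → x = 1)
    (hg : HasCost S ε c κ g) : g = 1 := by
  induction hg with
  | one _ => rfl
  | cons hk hx _ _ ih => rw [hc _ _ hk hx, ih, one_mul]

end HasCost

section Refinement

variable {α Q : Type*} [Group Q] {small : Set (α → ℕ)} {φ : (α → ℕ) → Q}

theorem exists_prod_map_eq_mul (hs : IsLowerSet small)
    (hφ : ∀ a b, a + b ∈ small → φ (a + b) = φ a * φ b)
    (hcomm : ∀ a ∈ small, ∀ b ∈ small, Commute (φ a) (φ b)) (L : List (α → ℕ))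
    (hL : ∀ x ∈ L, x ∈ small) {a : α → ℕ} (ha : a ∈ small) (haL : a ≤ L.sum) :
    ∃ L' : List (α → ℕ), (∀ x ∈ L', x ∈ small) ∧ L.sum = a + L'.sum ∧
      (L.map φ).prod = φ a * (L'.map φ).prod := by
  induction L generalizing a with
  | nil =>
    obtain rfl : a = 0 := le_antisymm haL fun _ => Nat.zero_le _
    exact ⟨[], by simp, by simp, by
      simp [show φ 0 = 1 by simpa using hφ 0 0 (by simpa using ha)]⟩
  | cons x L ih =>
    have hx := hL x (by simp)
    have hda : a ⊓ x + (a - a ⊓ x) = a := by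
      ext t; simp only [Pi.add_apply, Pi.sub_apply, Pi.inf_apply]; omega
    have hdx : a ⊓ x + (x - a ⊓ x) = x := by
      ext t; simp only [Pi.add_apply, Pi.sub_apply, Pi.inf_apply]; omega
    have ha' : a - a ⊓ x ∈ small := hs (fun t => Nat.sub_le _ _) ha
    have hx' : x - a ⊓ x ∈ small := hs (fun t => Nat.sub_le _ _) hx
    obtain ⟨L', hL', hsum, hprod⟩ := ih (fun y hy => hL y (by simp [hy])) ha' (by
      intro t
      have := haL t
      simp only [List.sum_cons, Pi.add_apply] at this
      simp only [Pi.sub_apply, Pi.inf_apply]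
      omega)
    refine ⟨(x - a ⊓ x) :: L', by simpa using ⟨hx', hL'⟩, ?_, ?_⟩
    · rw [List.sum_cons, List.sum_cons, hsum]
      calc x + (a - a ⊓ x + L'.sum) = a ⊓ x + (x - a ⊓ x) + (a - a ⊓ x + L'.sum) := by rw [hdx]
        _ = a ⊓ x + (a - a ⊓ x) + (x - a ⊓ x + L'.sum) :=
          add_add_add_comm ..
        _ = a + (x - a ⊓ x + L'.sum) := by rw [hda]
    · have e₁ := hφ (a ⊓ x) (a - a ⊓ x) (by rwa [hda])
      have e₂ := hφ (a ⊓ x) (x - a ⊓ x) (by rwa [hdx])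
      rw [hda] at e₁
      rw [hdx] at e₂
      rw [List.map_cons, List.prod_cons, List.map_cons, List.prod_cons, hprod, e₁, e₂]
      simp only [mul_assoc]
      rw [(hcomm _ hx' _ ha').left_comm]

theorem prod_map_eq_of_sum_eq (hs : IsLowerSet small)
    (hφ : ∀ a b, a + b ∈ small → φ (a + b) = φ a * φ b)
    (hcomm : ∀ a ∈ small, ∀ b ∈ small, Commute (φ a) (φ b)) (L L' : List (α → ℕ))
    (hL : ∀ x ∈ L, x ∈ small) (hL' : ∀ x ∈ L', x ∈ small) (h : L.sum = L'.sum) :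
    (L.map φ).prod = (L'.map φ).prod := by
  induction L generalizing L' with
  | nil =>
    rw [List.map_nil, List.prod_nil, eq_comm]
    refine List.prod_eq_one fun y hy => ?_
    obtain ⟨x, hx, rfl⟩ := List.mem_map.1 hy
    obtain rfl : x = 0 := by
      have := List.single_le_sum (l := L') (fun _ _ => fun _ => Nat.zero_le _) x hx
      rw [← h] at this
      exact le_antisymm this fun _ => Nat.zero_le _
    simpa using hφ 0 0 (by simpa using hL' _ hx)
  | cons x L ih =>
    obtain ⟨L'', hL'', hsum, hprod⟩ := exists_prod_map_eq_mul hs hφ hcomm L' hL'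
      (hL x (by simp)) (by rw [← h, List.sum_cons]; exact fun _ => Nat.le_add_right _ _)
    rw [hprod, List.map_cons, List.prod_cons, ih L'' (fun y hy => hL y (by simp [hy])) hL'' ?_]
    rw [List.sum_cons, hsum] at h
    exact add_left_cancel h

theorem prod_map_eq_one_of_sum_mem_closure (hs : IsLowerSet small)
    (hφ : ∀ a b, a + b ∈ small → φ (a + b) = φ a * φ b)
    (hcomm : ∀ a ∈ small, ∀ b ∈ small, Commute (φ a) (φ b)) (L : List (α → ℕ))
    (hL : ∀ x ∈ L, x ∈ small)
    (h : L.sum ∈ AddSubmonoid.closure {a | a ∈ small ∧ φ a = 1}) : (L.map φ).prod = 1 := by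
  obtain ⟨L', hL', hsum⟩ := AddSubmonoid.exists_list_of_mem_closure h
  rw [prod_map_eq_of_sum_eq hs hφ hcomm L L' hL (fun x hx => (hL' x hx).1) hsum.symm]
  refine List.prod_eq_one fun y hy => ?_
  obtain ⟨x, hx, rfl⟩ := List.mem_map.1 hy
  exact (hL' x hx).2

end Refinement

section Letters

variable {G : Type} [Group G] {S : Set G} {i j : ℕ} {ε κ : ℝ} {g : G}

/-- The subgroup generated by the iterated commutators of weight at least `i`. -/
def weightSubgroup (S : Set G) (i : ℕ) : Subgroup G :=
  Subgroup.closure {x | ∃ j, i ≤ j ∧ IsWeightedCommutator S j x}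

theorem HasCost.mem_weightSubgroup (hg : HasCost S ε i κ g) : g ∈ weightSubgroup S i := by
  induction hg with
  | one _ => exact one_mem _
  | cons hj hx _ _ ih => exact mul_mem (Subgroup.subset_closure ⟨_, hj, hx⟩) ih

theorem exists_hasCost_of_mem_weightSubgroup (hg : g ∈ weightSubgroup S i) :
    ∃ n : ℕ, ∀ ε : ℝ, 0 ≤ ε → ε ≤ 1 → HasCost S ε i (n * ε ^ i) g := by
  induction hg using Subgroup.closure_induction with
  | mem x hx =>
    obtain ⟨j, hj, hx⟩ := hx
    refine ⟨1, fun ε h0 h1 => (HasCost.of_isWeightedCommutator hj hx).mono ?_⟩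
    simpa using pow_le_pow_of_le_one h0 h1 hj
  | one => exact ⟨0, fun ε _ _ => .one (by simp)⟩
  | mul x y _ _ ihx ihy =>
    obtain ⟨n, hn⟩ := ihx
    obtain ⟨m, hm⟩ := ihy
    exact ⟨n + m, fun ε h0 h1 => ((hn ε h0 h1).mul (hm ε h0 h1)).mono (by push_cast; linarith)⟩
  | inv x _ ih =>
    obtain ⟨n, hn⟩ := ih
    exact ⟨n, fun ε h0 h1 => (hn ε h0 h1).inv⟩

variable [Fintype {x // IsWeightedCommutator S j x}]

/-- The word in the iterated commutators of weight `j` with prescribed multiplicities, in some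
order. -/
noncomputable def letterWord (e : {x // IsWeightedCommutator S j x} → ℕ) : List G :=
  (∑ x, e x • ({x.1} : Multiset G)).toList

theorem letterWord_add_perm (e f : {x // IsWeightedCommutator S j x} → ℕ) :
    (letterWord (e + f)).Perm (letterWord e ++ letterWord f) := by
  rw [← Multiset.coe_eq_coe, ← Multiset.coe_add]
  simp [letterWord, add_smul, Finset.sum_add_distrib]

theorem letterWord_nsmul_perm (n : ℕ) (e : {x // IsWeightedCommutator S j x} → ℕ) :
    (letterWord (n • e)).Perm (List.replicate n (letterWord e)).flatten := by
  induction n with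
  | zero => simp [letterWord]
  | succ n ih =>
    rw [succ_nsmul', List.replicate_succ, List.flatten_cons]
    exact (letterWord_add_perm _ _).trans (ih.append_left _)

@[simp]
theorem length_letterWord (e : {x // IsWeightedCommutator S j x} → ℕ) :
    (letterWord e).length = ∑ x, e x := by
  simp [letterWord]

theorem isWeightedCommutator_of_mem_letterWord {e : {x // IsWeightedCommutator S j x} → ℕ} {x : G}
    (hx : x ∈ letterWord e) : IsWeightedCommutator S j x := by
  rw [letterWord, Multiset.mem_toList, Multiset.mem_sum] at hx
  obtain ⟨y, -, hy⟩ := hx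
  obtain rfl := Multiset.mem_singleton.1 (Multiset.mem_of_mem_nsmul hy)
  exact y.2

theorem exists_letterWord_perm {L : List G} (hL : ∀ x ∈ L, IsWeightedCommutator S j x) :
    ∃ e : {x // IsWeightedCommutator S j x} → ℕ, L.Perm (letterWord e) := by
  classical
  induction L with
  | nil => exact ⟨0, by simp [letterWord]⟩
  | cons x L ih =>
    obtain ⟨e, he⟩ := ih fun y hy => hL y (by simp [hy])
    refine ⟨Pi.single ⟨x, hL x (by simp)⟩ 1 + e, ?_⟩
    refine (List.Perm.cons x he).trans (.symm ((letterWord_add_perm _ _).trans ?_))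
    have : letterWord (Pi.single ⟨x, hL x (by simp)⟩ 1 : {x // IsWeightedCommutator S j x} → ℕ)
        = [x] := by
      rw [letterWord, Finset.sum_eq_single ⟨x, hL x (by simp)⟩]
      · simp
      · intro b _ hb
        simp [Pi.single_eq_of_ne hb]
      · simp
    rw [this]
    rfl

theorem hasCost_letterWord (e : {x // IsWeightedCommutator S j x} → ℕ)
    (hκ : (∑ x, e x : ℕ) * ε ^ j ≤ κ) : HasCost S ε j κ (letterWord e).prod := by
  refine (HasCost.list_prod fun x hx => isWeightedCommutator_of_mem_letterWord hx).mono ?_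
  rwa [length_letterWord]

theorem exists_letterWord_add (hε : 0 ≤ ε) (hj : 1 ≤ j)
    (e f : {x // IsWeightedCommutator S j x} → ℕ)
    (hκ : (∑ x, (e + f) x : ℕ) * ε ^ j ≤ κ) :
    ∃ v, (letterWord (e + f)).prod = v * ((letterWord e).prod * (letterWord f).prod) ∧
      HasCost S ε (j + 1) (κ ^ 2 * Real.exp (2 * κ)) v := by
  rw [← List.prod_append]
  exact HasCost.exists_perm hε hj (letterWord_add_perm e f)
    (fun x hx => isWeightedCommutator_of_mem_letterWord hx) (by rwa [length_letterWord])

theorem exists_letterWord_nsmul (hε : 0 ≤ ε) (hj : 1 ≤ j) (n : ℕ)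
    (e : {x // IsWeightedCommutator S j x} → ℕ)
    (hκ : (∑ x, (n • e) x : ℕ) * ε ^ j ≤ κ) :
    ∃ v, (letterWord (n • e)).prod = v * (letterWord e).prod ^ n ∧
      HasCost S ε (j + 1) (κ ^ 2 * Real.exp (2 * κ)) v := by
  have h : (List.replicate n (letterWord e)).flatten.prod = (letterWord e).prod ^ n := by
    simp [List.prod_flatten]
  rw [← h]
  exact HasCost.exists_perm hε hj (letterWord_nsmul_perm n e)
    (fun x hx => isWeightedCommutator_of_mem_letterWord hx) (by rwa [length_letterWord])

theorem HasCost.exists_eq_mul_letterWord (hε : 0 ≤ ε) (hj : 1 ≤ j) (hg : HasCost S ε j κ g) :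
    ∃ v, ∃ e : {x // IsWeightedCommutator S j x} → ℕ, g = v * (letterWord e).prod ∧
      HasCost S ε (j + 1) (κ * Real.exp κ + κ ^ 2 * Real.exp (2 * κ)) v ∧
      (∑ x, e x : ℕ) * ε ^ j ≤ κ := by
  obtain ⟨v, L, rfl, hv, hL, hlen⟩ := hg.exists_collect hε
  obtain ⟨e, he⟩ := exists_letterWord_perm hL
  obtain ⟨w, hw, hwc⟩ := HasCost.exists_perm hε hj he hL hlen
  refine ⟨v * w, e, by rw [hw, mul_assoc], hv.mul hwc, ?_⟩
  rwa [← length_letterWord, ← he.length_eq]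

theorem letterWord_add_mem_iff (hj : 1 ≤ j) (e f : {x // IsWeightedCommutator S j x} → ℕ) :
    (letterWord (e + f)).prod ∈ weightSubgroup S (j + 1) ↔
      (letterWord e).prod * (letterWord f).prod ∈ weightSubgroup S (j + 1) := by
  obtain ⟨v, hv, hvc⟩ := exists_letterWord_add (ε := 1) zero_le_one hj e f le_rfl
  rw [hv, Subgroup.mul_mem_cancel_left _ hvc.mem_weightSubgroup]

/-- The exponent vectors of words of weight `j` that can be rewritten in higher weights. -/
noncomputable def relationMonoid (S : Set G) (hj : 1 ≤ j)
    [Fintype {x // IsWeightedCommutator S j x}] :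
    AddSubmonoid ({x // IsWeightedCommutator S j x} → ℕ) where
  carrier := {e | (letterWord e).prod ∈ weightSubgroup S (j + 1)}
  zero_mem' := by simp [letterWord, one_mem]
  add_mem' ha hb := (letterWord_add_mem_iff hj _ _).2 (mul_mem ha hb)

theorem exists_generators_relationMonoid (hj : 1 ≤ j) :
    ∃ F : Finset ({x // IsWeightedCommutator S j x} → ℕ), ∃ B : ℕ, 1 ≤ B ∧
      relationMonoid S hj = AddSubmonoid.closure F ∧ ∀ s ∈ F, ∑ x, s x ≤ B ∧
        ∀ ε : ℝ, 0 ≤ ε → ε ≤ 1 → HasCost S ε (j + 1) (B * ε ^ (j + 1)) (letterWord s).prod := by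
  have hfg : (relationMonoid S hj).FG := AddSubmonoid.fg_of_subtractive fun e he f hf =>
    (Subgroup.mul_mem_cancel_left _ he).1 ((letterWord_add_mem_iff hj e f).1 hf)
  obtain ⟨F, hF⟩ := hfg
  have h : ∀ s ∈ F, ∃ n : ℕ, ∀ ε : ℝ, 0 ≤ ε → ε ≤ 1 →
      HasCost S ε (j + 1) (n * ε ^ (j + 1)) (letterWord s).prod := fun s hs =>
    exists_hasCost_of_mem_weightSubgroup
      (show s ∈ relationMonoid S hj from hF ▸ AddSubmonoid.subset_closure hs)
  choose! n hn using h
  refine ⟨F, 1 + F.sup n + F.sup fun s => ∑ x, s x, by omega, hF.symm, fun s hs => ⟨?_, ?_⟩⟩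
  · have : ∑ x, s x ≤ _ := Finset.le_sup (f := fun s => ∑ x, s x) hs
    omega
  · intro ε h0 h1
    refine (hn s hs ε h0 h1).mono ?_
    gcongr
    have := Finset.le_sup (f := n) hs
    omega

end Letters

section LocalSection

variable {G : Type} [Group G] {S : Set G} {ι : Type} {m : ι → ℕ} {κ μ : ℝ} {i j : ℕ}

/-- The families `u` with `u k` of cost at most `κ` at scale `m k`, for every `k`. -/
def UniformCost (S : Set G) (m : ι → ℕ) (i : ℕ) (κ : ℝ) (u : ι → G) : Prop :=
  ∀ k, HasCost S (m k : ℝ)⁻¹ i κ (u k)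

namespace UniformCost

variable {u v : ι → G}

theorem mono (h : κ ≤ μ) (hu : UniformCost S m i κ u) : UniformCost S m i μ u :=
  fun k => (hu k).mono h

theorem anti (h : j ≤ i) (hu : UniformCost S m i κ u) : UniformCost S m j κ u :=
  fun k => (hu k).anti h

theorem one (h : 0 ≤ κ) : UniformCost S m i κ 1 := fun _ => .one h

theorem mul (hu : UniformCost S m i κ u) (hv : UniformCost S m i μ v) :
    UniformCost S m i (κ + μ) (u * v) := fun k => (hu k).mul (hv k)

theorem inv (hu : UniformCost S m i κ u) : UniformCost S m i κ u⁻¹ := fun k => (hu k).inv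

theorem commutator (hu : UniformCost S m i κ u) (hv : UniformCost S m j μ v) :
    UniformCost S m (i + j) (κ * μ * Real.exp (κ + μ)) ⁅u, v⁆ :=
  fun k => (hu k).commutator (by positivity) (hv k)

end UniformCost

/-- A group over `ι → G`, generated by the lifts of the families of cost at most `1` along a
section that is multiplicative on families of cost at most `κ`. -/
structure LocalSection (S : Set G) (m : ι → ℕ) (κ : ℝ) (Γ : Type) [Group Γ] where
  /-- The projection. -/
  ev : Γ →* (ι → G)
  /-- The section. -/
  lift : (ι → G) → Γ
  ev_lift : ∀ u, UniformCost S m 1 κ u → ev (lift u) = u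
  lift_mul : ∀ u v, UniformCost S m 1 κ u → UniformCost S m 1 κ v → UniformCost S m 1 κ (u * v) →
    lift (u * v) = lift u * lift v
  closure_eq_top : Subgroup.closure (lift '' {u | UniformCost S m 1 1 u}) = ⊤

namespace LocalSection

variable {Γ : Type} [Group Γ] (L : LocalSection S m κ Γ) {u v : ι → G}

/-- The subgroup generated by the lifts of the families of cost at most `1` in weights at least
`i`. -/
def filtration (i : ℕ) : Subgroup Γ := Subgroup.closure (L.lift '' {u | UniformCost S m i 1 u})

include L in
theorem lift_one (hκ : 0 ≤ κ) : L.lift 1 = 1 := by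
  have h : UniformCost S m 1 κ (1 : ι → G) := .one hκ
  simpa using L.lift_mul 1 1 h h (by simpa using h)

theorem lift_inv (hκ : 0 ≤ κ) (hu : UniformCost S m 1 κ u) : L.lift u⁻¹ = (L.lift u)⁻¹ := by
  rw [eq_inv_iff_mul_eq_one, ← L.lift_mul _ _ hu.inv hu (by simpa using .one hκ), inv_mul_cancel,
    L.lift_one hκ]

theorem lift_mem_filtration (hm : ∀ k, 1 ≤ m k) (hκ : 2 ≤ κ) (hi : 1 ≤ i) (n : ℕ) (hn : n ≤ κ)
    (hu : UniformCost S m i n u) : L.lift u ∈ L.filtration i := by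
  induction n generalizing u with
  | zero =>
    exact Subgroup.subset_closure ⟨u, hu.mono (by simp), rfl⟩
  | succ n ih =>
    have h : ∀ k, ∃ a b r, u k = a * b * r ∧ HasCost S (m k : ℝ)⁻¹ i 1 a ∧
        HasCost S (m k : ℝ)⁻¹ i 1 b ∧ HasCost S (m k : ℝ)⁻¹ i n r := fun k => by
      have hk : (1 : ℝ) ≤ m k := by exact_mod_cast hm k
      obtain ⟨a, b, r, h, ha, hb, hr⟩ :=
        (hu k).exists_split (by positivity) (inv_le_one_of_one_le₀ hk) 1 zero_le_one
      exact ⟨a, b, r, h, ha, hb, by simpa using hr⟩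
    choose a b r hur ha hb hr using h
    obtain rfl : u = a * b * r := funext hur
    push_cast at hn
    have hab : UniformCost S m i (1 + 1) (a * b) := UniformCost.mul (u := a) ha hb
    have ha' : UniformCost S m i 1 a := ha
    have hb' : UniformCost S m i 1 b := hb
    have hr' : UniformCost S m i n r := hr
    rw [L.lift_mul _ _ ((hab.mono (by linarith)).anti hi) ((hr'.mono (by linarith)).anti hi)
      ((hu.mono (by push_cast; linarith)).anti hi), L.lift_mul _ _
      ((ha'.mono (by linarith)).anti hi) ((hb'.mono (by linarith)).anti hi)
      ((hab.mono (by linarith)).anti hi)]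
    exact mul_mem (mul_mem (Subgroup.subset_closure ⟨a, ha, rfl⟩)
      (Subgroup.subset_closure ⟨b, hb, rfl⟩)) (ih (by linarith) hr)

theorem normal_filtration (hm : ∀ k, 1 ≤ m k) (hκ : 3 ≤ κ) (hi : 1 ≤ i) :
    (L.filtration i).Normal := by
  have conj : ∀ u, UniformCost S m 1 1 u → ∀ n ∈ L.filtration i,
      L.lift u * n * (L.lift u)⁻¹ ∈ L.filtration i := by
    intro u hu n hn
    induction hn using Subgroup.closure_induction with
    | mem x hx =>
      obtain ⟨v, hv, rfl⟩ := hx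
      have hv' : UniformCost S m 1 1 v := UniformCost.anti hi hv
      rw [← L.lift_inv (by linarith) (hu.mono (by linarith)), ← L.lift_mul _ _
        (hu.mono (by linarith)) (hv'.mono (by linarith)) ((hu.mul hv').mono (by linarith)),
        ← L.lift_mul _ _ ((hu.mul hv').mono (by linarith)) (hu.inv.mono (by linarith))
        (((hu.mul hv').mul hu.inv).mono (by linarith))]
      refine L.lift_mem_filtration hm (by linarith) hi 3 (by simpa using hκ) fun k =>
        ((hu k).conj (by positivity) (hv k)).mono ?_
      have := Real.exp_one_lt_d9
      push_cast
      linarith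
    | one => simp [one_mem]
    | mul x y _ _ hx hy =>
      rw [show L.lift u * (x * y) * (L.lift u)⁻¹ = L.lift u * x * (L.lift u)⁻¹ *
        (L.lift u * y * (L.lift u)⁻¹) by group]
      exact mul_mem hx hy
    | inv x _ hx =>
      rw [show L.lift u * x⁻¹ * (L.lift u)⁻¹ = (L.lift u * x * (L.lift u)⁻¹)⁻¹ by group]
      exact inv_mem hx
  refine ⟨fun n hn g => ?_⟩
  have hg : g ∈ Subgroup.closure (L.lift '' {u | UniformCost S m 1 1 u}) := by
    simp [L.closure_eq_top]
  induction hg using Subgroup.closure_induction'' generalizing n with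
  | mem x hx =>
    obtain ⟨u, hu, rfl⟩ := hx
    exact conj u hu n hn
  | inv_mem x hx =>
    obtain ⟨u, hu, rfl⟩ := hx
    rw [← L.lift_inv (by linarith) (UniformCost.mono (by linarith) hu)]
    exact conj _ hu.inv n hn
  | one => simpa using hn
  | mul x y _ _ hx hy =>
    rw [show x * y * n * (x * y)⁻¹ = x * (y * n * y⁻¹) * x⁻¹ by group]
    exact hx _ (hy n hn)

theorem ev_mem_weightSubgroup (hκ : 1 ≤ κ) (hi : 1 ≤ i) {p : Γ} (hp : p ∈ L.filtration i) (k : ι) :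
    L.ev p k ∈ weightSubgroup S i := by
  have : L.filtration i ≤
      ((weightSubgroup S i).comap (Pi.evalMonoidHom (fun _ : ι => G) k)).comap L.ev := by
    rw [filtration, Subgroup.closure_le]
    rintro _ ⟨u, hu, rfl⟩
    simp only [SetLike.mem_coe, Subgroup.mem_comap, Pi.evalMonoidHom_apply]
    rw [L.ev_lift u (UniformCost.anti hi (UniformCost.mono hκ hu))]
    exact (hu k).mem_weightSubgroup
  exact this hp

end LocalSection
end LocalSection

section LetterFamily

variable {G : Type} [Group G] {S : Set G} {ι : Type} {m : ι → ℕ} {κ : ℝ} {j B : ℕ}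

theorem mul_inv_pow_le {s B m : ℕ} (hm : 1 ≤ m) (h : s ≤ B * m ^ j) :
    (s : ℝ) * (m : ℝ)⁻¹ ^ j ≤ B := by
  have hm' : (0 : ℝ) < m := by exact_mod_cast hm
  rw [inv_pow, ← div_eq_mul_inv, div_le_iff₀ (by positivity)]
  exact_mod_cast h

variable [Fintype {x // IsWeightedCommutator S j x}]

/-- The family of the words of weight `j` with prescribed exponents. -/
noncomputable def letterFamily (a : ι × {x // IsWeightedCommutator S j x} → ℕ) : ι → G :=
  fun k => (letterWord fun x => a (k, x)).prod

variable (S m j B) in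
/-- The families of exponents of size at most `B * m k ^ j`. -/
def smallExponents : Set (ι × {x // IsWeightedCommutator S j x} → ℕ) :=
  {a | ∀ k, ∑ x, a (k, x) ≤ B * m k ^ j}

theorem isLowerSet_smallExponents : IsLowerSet (smallExponents S m j B) :=
  fun _ _ hba ha k => (Finset.sum_le_sum fun x _ => hba (k, x)).trans (ha k)

theorem uniformCost_letterFamily (hm : ∀ k, 1 ≤ m k)
    {a : ι × {x // IsWeightedCommutator S j x} → ℕ} (ha : a ∈ smallExponents S m j B) :
    UniformCost S m j B (letterFamily a) :=
  fun k => hasCost_letterWord _ (mul_inv_pow_le (hm k) (ha k))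

theorem exists_letterFamily_add (hm : ∀ k, 1 ≤ m k) (hj : 1 ≤ j)
    {a b : ι × {x // IsWeightedCommutator S j x} → ℕ} (hab : a + b ∈ smallExponents S m j B) :
    ∃ v, UniformCost S m (j + 1) ((B : ℝ) ^ 2 * Real.exp (2 * B)) v ∧
      letterFamily (a + b) = v * (letterFamily a * letterFamily b) := by
  choose v hv hc using fun k => exists_letterWord_add (ε := (m k : ℝ)⁻¹) (κ := B) (by positivity) hj
    (fun x => a (k, x)) (fun x => b (k, x)) (mul_inv_pow_le (hm k) (hab k))
  exact ⟨v, hc, funext hv⟩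

theorem exists_list_prod_letterFamily (hj : 1 ≤ j)
    (l : List (ι × {x // IsWeightedCommutator S j x} → ℕ)) (k : ι) :
    ∃ h ∈ weightSubgroup S (j + 1), (l.map fun a => letterFamily a k).prod =
      h * letterFamily l.sum k := by
  induction l using List.reverseRecOn with
  | nil => exact ⟨1, one_mem _, by simp [letterFamily, letterWord]⟩
  | append_singleton l a ih =>
    obtain ⟨h, hh, hl⟩ := ih
    obtain ⟨v, hv, hvc⟩ := exists_letterWord_add (ε := 1) zero_le_one hj
      (fun x => l.sum (k, x)) (fun x => a (k, x)) le_rfl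
    refine ⟨h * v⁻¹, mul_mem hh (inv_mem hvc.mem_weightSubgroup), ?_⟩
    have e : letterFamily (l ++ [a]).sum k =
        v * (letterFamily l.sum k * letterFamily a k) := by
      rw [List.sum_append, List.sum_singleton]
      exact hv
    rw [e, List.map_append, List.prod_append, hl]
    simp [mul_assoc]

end LetterFamily

namespace LocalSection

variable {G : Type} [Group G] {S : Set G} {ι : Type} {m : ι → ℕ} {κ : ℝ} {j B n : ℕ}
  {Γ : Type} [Group Γ] (L : LocalSection S m κ Γ)

section

variable [(L.filtration (j + 1)).Normal]

/-- The class of the lift of a family modulo the next term of the filtration. -/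
def liftMod (j : ℕ) [(L.filtration (j + 1)).Normal] (u : ι → G) : Γ ⧸ L.filtration (j + 1) :=
  QuotientGroup.mk' _ (L.lift u)

theorem liftMod_eq_one (hm : ∀ k, 1 ≤ m k) (hκ : 2 ≤ κ) (hn : n ≤ κ) {u : ι → G}
    (hu : UniformCost S m (j + 1) n u) : L.liftMod j u = 1 :=
  (QuotientGroup.eq_one_iff _).2 (L.lift_mem_filtration hm hκ (by omega) n hn hu)

theorem liftMod_mul {u v : ι → G} (hu : UniformCost S m 1 κ u) (hv : UniformCost S m 1 κ v)
    (huv : UniformCost S m 1 κ (u * v)) : L.liftMod j (u * v) = L.liftMod j u * L.liftMod j v := by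
  rw [liftMod, L.lift_mul u v hu hv huv, map_mul]
  rfl

theorem liftMod_mul_of_higher (hm : ∀ k, 1 ≤ m k) (hκ : 2 ≤ κ) (hn : n ≤ κ) {u v : ι → G}
    (hv : UniformCost S m (j + 1) n v) (hu : UniformCost S m 1 κ u)
    (hvu : UniformCost S m 1 κ (v * u)) : L.liftMod j (v * u) = L.liftMod j u := by
  rw [L.liftMod_mul ((hv.mono hn).anti (by omega)) hu hvu, L.liftMod_eq_one hm hκ hn hv, one_mul]

variable [Fintype {x // IsWeightedCommutator S j x}]

theorem liftMod_letterFamily_add (hm : ∀ k, 1 ≤ m k) (hj : 1 ≤ j)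
    (hn : (B : ℝ) ^ 2 * Real.exp (2 * B) + 2 * B + 3 ≤ n) (hκ : n ≤ κ)
    {a b : ι × {x // IsWeightedCommutator S j x} → ℕ} (hab : a + b ∈ smallExponents S m j B) :
    L.liftMod j (letterFamily (a + b)) =
      L.liftMod j (letterFamily a) * L.liftMod j (letterFamily b) := by
  have h0 : 0 ≤ (B : ℝ) ^ 2 * Real.exp (2 * B) := by positivity
  have h1 : (0 : ℝ) ≤ B := by positivity
  have ha := (uniformCost_letterFamily hm
    (isLowerSet_smallExponents (fun _ => Nat.le_add_right _ _) hab : a ∈ _)).anti hj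
  have hb := (uniformCost_letterFamily hm
    (isLowerSet_smallExponents (fun _ => Nat.le_add_left _ _) hab : b ∈ _)).anti hj
  have hab' := (uniformCost_letterFamily hm hab).anti hj
  obtain ⟨v, hv, e⟩ := exists_letterFamily_add hm hj hab
  rw [e] at hab' ⊢
  rw [L.liftMod_mul_of_higher hm (by linarith) hκ (hv.mono (by linarith))
    ((ha.mul hb).mono (by linarith)) (hab'.mono (by linarith)),
    L.liftMod_mul (ha.mono (by linarith)) (hb.mono (by linarith))
    ((ha.mul hb).mono (by linarith))]

theorem commute_liftMod_letterFamily (hm : ∀ k, 1 ≤ m k) (hj : 1 ≤ j)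
    (hn : (B : ℝ) ^ 2 * Real.exp (2 * B) + 2 * B + 3 ≤ n) (hκ : n ≤ κ)
    {a b : ι × {x // IsWeightedCommutator S j x} → ℕ} (ha : a ∈ smallExponents S m j B)
    (hb : b ∈ smallExponents S m j B) :
    Commute (L.liftMod j (letterFamily a)) (L.liftMod j (letterFamily b)) := by
  have h0 : 0 ≤ (B : ℝ) ^ 2 * Real.exp (2 * B) := by positivity
  have h1 : (0 : ℝ) ≤ B := by positivity
  have ha' := uniformCost_letterFamily hm ha
  have hb' := uniformCost_letterFamily hm hb
  have hc := (ha'.commutator hb').anti (by omega : j + 1 ≤ j + j)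
  rw [← two_mul, ← pow_two] at hc
  have hab := ((ha'.mul hb').mono (by linarith : _ ≤ κ)).anti hj
  have hba := ((hb'.mul ha').mono (by linarith : _ ≤ κ)).anti hj
  have e : letterFamily a * letterFamily b =
      ⁅letterFamily a, letterFamily b⁆ * (letterFamily b * letterFamily a) := by
    simp only [commutatorElement_def]; group
  rw [commute_iff_eq, ← L.liftMod_mul ((ha'.mono (by linarith)).anti hj)
    ((hb'.mono (by linarith)).anti hj) hab, ← L.liftMod_mul ((hb'.mono (by linarith)).anti hj)
    ((ha'.mono (by linarith)).anti hj) hba]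
  rw [e] at hab ⊢
  exact L.liftMod_mul_of_higher hm (by linarith) hκ (hc.mono (by linarith)) hba hab

theorem liftMod_letterFamily_smul_eq_one (hm : ∀ k, 1 ≤ m k) (hj : 1 ≤ j)
    (hn : (B : ℝ) ^ 2 * Real.exp (2 * B) + 2 * B + 3 ≤ n) (hκ : n ≤ κ)
    {s : {x // IsWeightedCommutator S j x} → ℕ} (hs : ∑ x, s x ≤ B)
    (hsc : ∀ ε : ℝ, 0 ≤ ε → ε ≤ 1 → HasCost S ε (j + 1) (B * ε ^ (j + 1)) (letterWord s).prod)
    {f : ι → ℕ} (hf : ∀ k, f k ≤ m k ^ j) :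
    (fun p : ι × _ => f p.1 * s p.2) ∈ smallExponents S m j B ∧
      L.liftMod j (letterFamily fun p => f p.1 * s p.2) = 1 := by
  have hsmall : (fun p : ι × _ => f p.1 * s p.2) ∈ smallExponents S m j B := fun k => by
    change ∑ x, f k * s x ≤ _
    rw [← Finset.mul_sum, mul_comm]
    exact Nat.mul_le_mul hs (hf k)
  refine ⟨hsmall, L.liftMod_eq_one hm ?_ hκ fun k => ?_⟩
  · have : 0 ≤ (B : ℝ) ^ 2 * Real.exp (2 * B) := by positivity
    linarith [(by positivity : (0 : ℝ) ≤ B)]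
  · have hk : (1 : ℝ) ≤ m k := by exact_mod_cast hm k
    have hi0 : (0 : ℝ) ≤ (m k : ℝ)⁻¹ := by positivity
    have hi1 : (m k : ℝ)⁻¹ ≤ 1 := inv_le_one_of_one_le₀ hk
    obtain ⟨v, hv, hvc⟩ := exists_letterWord_nsmul hi0 hj (f k) s
      (mul_inv_pow_le (hm k) (hsmall k))
    have e : letterFamily (fun p : ι × _ => f p.1 * s p.2) k = v * (letterWord s).prod ^ f k := hv
    rw [e]
    refine (hvc.mul ((hsc _ hi0 hi1).pow (f k))).mono ?_
    have h1 : (f k : ℝ) * (B * (m k : ℝ)⁻¹ ^ (j + 1)) ≤ B := by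
      calc (f k : ℝ) * (B * (m k : ℝ)⁻¹ ^ (j + 1))
          = B * (f k * (m k : ℝ)⁻¹ ^ j) * (m k : ℝ)⁻¹ := by rw [pow_succ]; ring
        _ ≤ B * (1 : ℕ) * 1 := by
            gcongr
            exact mul_inv_pow_le (hm k) (by simpa using hf k)
        _ = B := by simp
    linarith [(by positivity : (0 : ℝ) ≤ B)]

theorem smul_mem_closure (hm : ∀ k, 1 ≤ m k) (hj : 1 ≤ j)
    (hn : (B : ℝ) ^ 2 * Real.exp (2 * B) + 2 * B + 3 ≤ n) (hκ : n ≤ κ)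
    {s : {x // IsWeightedCommutator S j x} → ℕ} (hs : ∑ x, s x ≤ B)
    (hsc : ∀ ε : ℝ, 0 ≤ ε → ε ≤ 1 → HasCost S ε (j + 1) (B * ε ^ (j + 1)) (letterWord s).prod)
    (M : ℕ) {f : ι → ℕ} (hf : ∀ k, f k ≤ M * m k ^ j) :
    (fun p : ι × _ => f p.1 * s p.2) ∈ AddSubmonoid.closure
      {a | a ∈ smallExponents S m j B ∧ L.liftMod j (letterFamily a) = 1} := by
  induction M generalizing f with
  | zero =>
    have : (fun p : ι × {x // IsWeightedCommutator S j x} => f p.1 * s p.2) = 0 := by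
      ext p
      have := hf p.1
      simp_all
    rw [this]
    exact zero_mem _
  | succ M ih =>
    have : (fun p : ι × {x // IsWeightedCommutator S j x} => f p.1 * s p.2) =
        (fun p => min (f p.1) (m p.1 ^ j) * s p.2) +
        (fun p => (f p.1 - min (f p.1) (m p.1 ^ j)) * s p.2) := by
      ext p
      rw [Pi.add_apply, ← add_mul]
      congr 1
      omega
    rw [this]
    refine add_mem (AddSubmonoid.subset_closure
      (L.liftMod_letterFamily_smul_eq_one hm hj hn hκ hs hsc fun k => min_le_right _ _))
      (ih (f := fun k => f k - min (f k) (m k ^ j)) fun k => ?_)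
    have := hf k
    rw [add_mul] at this
    omega

theorem exists_eq_liftMod_letterFamily (hm : ∀ k, 1 ≤ m k) (hj : 1 ≤ j) (hB : 1 ≤ B)
    (hn : Real.exp 1 + Real.exp 2 + 3 ≤ n) (hBκ : B ≤ κ) (hκ : n ≤ κ) {u : ι → G}
    (hu : UniformCost S m j 1 u) :
    ∃ a ∈ smallExponents S m j B, L.liftMod j u = L.liftMod j (letterFamily a) := by
  have h1 := Real.exp_pos 1
  have h2 := Real.exp_pos 2
  choose v e he hv hs using fun k => (hu k).exists_eq_mul_letterWord (by positivity) hj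
  have ha : (fun p : ι × _ => e p.1 p.2) ∈ smallExponents S m j B := fun k => by
    have hk : (0 : ℝ) < m k := by exact_mod_cast hm k
    have := hs k
    rw [inv_pow, ← div_eq_mul_inv, div_le_iff₀ (by positivity), one_mul] at this
    calc ∑ x, e k x ≤ m k ^ j := by exact_mod_cast this
      _ ≤ B * m k ^ j := Nat.le_mul_of_pos_left _ (by omega)
  refine ⟨_, ha, ?_⟩
  obtain rfl : u = v * letterFamily (fun p : ι × _ => e p.1 p.2) := funext he
  have hv' : UniformCost S m (j + 1) n v := fun k => (hv k).mono (by
    simp only [one_mul, mul_one, one_pow]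
    linarith)
  exact L.liftMod_mul_of_higher hm (by linarith) hκ hv'
    (((uniformCost_letterFamily hm ha).mono (by exact_mod_cast hBκ)).anti hj)
    ((hu.mono (by linarith)).anti hj)

theorem exists_list_liftMod (hm : ∀ k, 1 ≤ m k) (hj : 1 ≤ j) (hB : 1 ≤ B)
    (hn : Real.exp 1 + Real.exp 2 + 3 ≤ n) (hBκ : B ≤ κ) (hκ : n ≤ κ) {p : Γ}
    (hp : p ∈ L.filtration j) :
    ∃ l : List (ι × {x // IsWeightedCommutator S j x} → ℕ), (∀ a ∈ l, a ∈ smallExponents S m j B) ∧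
      QuotientGroup.mk' _ p = (l.map fun a => L.liftMod j (letterFamily a)).prod := by
  have hκ1 : 1 ≤ κ := by linarith [Real.exp_pos 1, Real.exp_pos 2]
  have lift : ∀ u, UniformCost S m j 1 u → ∃ l : List (ι × {x // IsWeightedCommutator S j x} → ℕ),
      (∀ a ∈ l, a ∈ smallExponents S m j B) ∧
      QuotientGroup.mk' _ (L.lift u) = (l.map fun a => L.liftMod j (letterFamily a)).prod := by
    intro u hu
    obtain ⟨a, ha, e⟩ := L.exists_eq_liftMod_letterFamily hm hj hB hn hBκ hκ hu
    exact ⟨[a], by simpa using ha, by rw [List.map_singleton, List.prod_singleton, ← e]; rfl⟩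
  induction hp using Subgroup.closure_induction'' with
  | mem x hx =>
    obtain ⟨u, hu, rfl⟩ := hx
    exact lift u hu
  | inv_mem x hx =>
    obtain ⟨u, hu, rfl⟩ := hx
    rw [← L.lift_inv (by linarith) (UniformCost.anti hj (UniformCost.mono hκ1 hu))]
    exact lift _ hu.inv
  | one => exact ⟨[], by simp, by simp⟩
  | mul x y _ _ hx hy =>
    obtain ⟨l, hl, e⟩ := hx
    obtain ⟨l', hl', e'⟩ := hy
    refine ⟨l ++ l', ?_, by rw [map_mul, e, e']; simp⟩
    intro a ha
    rcases List.mem_append.1 ha with ha | ha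
    exacts [hl a ha, hl' a ha]

theorem letterFamily_sum_mem_weightSubgroup (hm : ∀ k, 1 ≤ m k) (hj : 1 ≤ j) (hκ : 1 ≤ κ)
    (hBκ : B ≤ κ) {l : List (ι × {x // IsWeightedCommutator S j x} → ℕ)}
    (hl : ∀ a ∈ l, a ∈ smallExponents S m j B) {p : Γ} (hp : L.ev p = 1)
    (hpl : QuotientGroup.mk' _ p = (l.map fun a => L.liftMod j (letterFamily a)).prod) (k : ι) :
    letterFamily l.sum k ∈ weightSubgroup S (j + 1) := by
  have e : ((l.map fun a => L.lift (letterFamily a)).prod)⁻¹ * p ∈ L.filtration (j + 1) := by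
    rw [← QuotientGroup.eq]
    refine Eq.trans ?_ hpl.symm
    change QuotientGroup.mk' (L.filtration (j + 1)) _ = _
    rw [map_list_prod, List.map_map]
    rfl
  have h := L.ev_mem_weightSubgroup hκ (by omega) e k
  rw [map_mul, hp, mul_one, map_inv, Pi.inv_apply, inv_mem_iff, map_list_prod, List.map_map] at h
  have h' : (l.map (L.ev ∘ fun a => L.lift (letterFamily a))) = l.map letterFamily :=
    List.map_congr_left fun a ha => L.ev_lift _ (((uniformCost_letterFamily hm (hl a ha)).mono
      hBκ).anti hj)
  rw [h', Pi.list_prod_apply, List.map_map] at h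
  obtain ⟨g, hg, hgl⟩ := exists_list_prod_letterFamily hj l k
  rw [← Subgroup.mul_mem_cancel_left _ hg, ← hgl]
  exact h

end

theorem mem_filtration_succ_of_ev_eq_one [Fintype {x // IsWeightedCommutator S j x}] (hj : 1 ≤ j)
    (hm : ∀ k, 1 ≤ m k) (hB : 1 ≤ B)
    (hn : (B : ℝ) ^ 2 * Real.exp (2 * B) + 2 * B + 3 + Real.exp 1 + Real.exp 2 ≤ n) (hκ : n ≤ κ)
    {F : Finset ({x // IsWeightedCommutator S j x} → ℕ)}
    (hF : relationMonoid S hj = AddSubmonoid.closure F)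
    (hFB : ∀ s ∈ F, ∑ x, s x ≤ B ∧
      ∀ ε : ℝ, 0 ≤ ε → ε ≤ 1 → HasCost S ε (j + 1) (B * ε ^ (j + 1)) (letterWord s).prod)
    {p : Γ} (hp : p ∈ L.filtration j) (hp1 : L.ev p = 1) : p ∈ L.filtration (j + 1) := by
  have h0 : 0 ≤ (B : ℝ) ^ 2 * Real.exp (2 * B) := by positivity
  have h1 := Real.exp_pos 1
  have h2 := Real.exp_pos 2
  have h3 : (0 : ℝ) ≤ B := by positivity
  have := L.normal_filtration hm (by linarith) (by omega : 1 ≤ j + 1)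
  obtain ⟨l, hl, hpl⟩ := L.exists_list_liftMod hm hj hB (by linarith) (by linarith) hκ hp
  have hmem : ∀ k, (fun x => l.sum (k, x)) ∈ relationMonoid S hj := fun k =>
    L.letterFamily_sum_mem_weightSubgroup hm hj (by linarith) (by linarith) hl hp1 hpl k
  have hsum : ∀ k, ∑ x, l.sum (k, x) ≤ l.length * B * m k ^ j := by
    clear hpl hmem
    intro k
    induction l with
    | nil => simp
    | cons a l ih =>
      have := hl a (by simp) k
      have := ih fun b hb => hl b (by simp [hb])
      simp only [List.sum_cons, Pi.add_apply, Finset.sum_add_distrib, List.length_cons]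
      linarith
  simp only [hF, AddSubmonoid.mem_closure_finset] at hmem
  choose f _ hf using hmem
  have hl_sum : l.sum = ∑ s ∈ F, fun p => f p.1 s * s p.2 := by
    ext ⟨k, x⟩
    have := congr_fun (hf k) x
    simp only [Finset.sum_apply, Pi.smul_apply, smul_eq_mul] at this ⊢
    exact this.symm
  rw [← QuotientGroup.eq_one_iff]
  change QuotientGroup.mk' _ p = 1
  rw [hpl]
  refine prod_map_eq_one_of_sum_mem_closure isLowerSet_smallExponents
    (fun a b => L.liftMod_letterFamily_add hm hj (by linarith) hκ)
    (fun a ha b hb => L.commute_liftMod_letterFamily hm hj (by linarith) hκ ha hb) l hl ?_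
  rw [hl_sum]
  refine sum_mem fun s hs => ?_
  by_cases hs0 : s = 0
  · subst hs0
    simp only [Pi.zero_apply, mul_zero]
    exact zero_mem _
  · refine L.smul_mem_closure hm hj (by linarith) hκ (hFB s hs).1 (hFB s hs).2 (l.length * B)
      (f := fun k => f k s) fun k => ?_
    obtain ⟨x, hx⟩ := Function.ne_iff.1 hs0
    refine le_trans ?_ (hsum k)
    calc f k s ≤ f k s * s x := Nat.le_mul_of_pos_right _ (Nat.pos_of_ne_zero hx)
      _ ≤ ∑ s ∈ F, f k s * s x :=
          Finset.single_le_sum (f := fun s => f k s * s x) (fun _ _ => Nat.zero_le _) hs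
      _ = l.sum (k, x) := by rw [hl_sum, Finset.sum_apply]
      _ ≤ _ := Finset.single_le_sum (f := fun x => l.sum (k, x)) (fun _ _ => Nat.zero_le _)
          (Finset.mem_univ x)

end LocalSection

theorem exists_bound_mem_filtration_succ {G : Type} [Group G] {S : Set G} (hS : S.Finite) {j : ℕ}
    (hj : 1 ≤ j) : ∃ K : ℝ, ∀ {ι : Type} {m : ι → ℕ} {κ : ℝ} {Γ : Type} [Group Γ]
      (L : LocalSection S m κ Γ), (∀ k, 1 ≤ m k) → K ≤ κ → ∀ p ∈ L.filtration j, L.ev p = 1 →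
      p ∈ L.filtration (j + 1) := by
  have : Fintype {x // IsWeightedCommutator S j x} :=
    (IsWeightedCommutator.finite hS j).fintype
  obtain ⟨F, B, hB, hF, hFB⟩ := exists_generators_relationMonoid (S := S) hj
  obtain ⟨n, hn⟩ := exists_nat_ge
    ((B : ℝ) ^ 2 * Real.exp (2 * B) + 2 * B + 3 + Real.exp 1 + Real.exp 2)
  exact ⟨n, fun L hm hκ p hp hp1 => L.mem_filtration_succ_of_ev_eq_one hj hm hB hn hκ hF hFB hp hp1⟩

theorem exists_bound_injective_ev {G : Type} [Group G] [Group.IsNilpotent G] {S : Set G}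
    (hS : S.Finite) : ∃ K : ℝ, ∀ {ι : Type} {m : ι → ℕ} {κ : ℝ} {Γ : Type} [Group Γ]
      (L : LocalSection S m κ Γ), (∀ k, 1 ≤ m k) → K ≤ κ → ∀ p, L.ev p = 1 → p = 1 := by
  obtain ⟨c, hc⟩ := IsWeightedCommutator.exists_eq_one S
  have H : ∀ i, ∃ K : ℝ, ∀ {ι : Type} {m : ι → ℕ} {κ : ℝ} {Γ : Type} [Group Γ]
      (L : LocalSection S m κ Γ), (∀ k, 1 ≤ m k) → K ≤ κ → ∀ p, L.ev p = 1 →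
      p ∈ L.filtration (i + 1) := by
    intro i
    induction i with
    | zero => exact ⟨0, fun L _ _ p _ => by simp [LocalSection.filtration, L.closure_eq_top]⟩
    | succ i ih =>
      obtain ⟨K, hK⟩ := ih
      obtain ⟨K', hK'⟩ := exists_bound_mem_filtration_succ hS (by omega : 1 ≤ i + 1)
      exact ⟨max K K', fun L hm hκ p hp => hK' L hm ((le_max_right _ _).trans hκ) p
        (hK L hm ((le_max_left _ _).trans hκ) p hp) hp⟩
  obtain ⟨K, hK⟩ := H c
  refine ⟨max K 0, fun {ι m κ Γ} _ L hm hκ p hp => ?_⟩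
  have h := hK L hm ((le_max_left _ _).trans hκ) p hp
  have h1 : L.filtration (c + 1) ≤ ⊥ := by
    rw [LocalSection.filtration, Subgroup.closure_le]
    rintro _ ⟨u, hu, rfl⟩
    obtain rfl : u = 1 := funext fun k => ((hu k).anti (by omega)).eq_one hc
    exact L.lift_one ((le_max_right _ _).trans hκ)
  exact h1 h

namespace HasCost

variable {G : Type} [Group G] {S : Set G} {ε : ℝ} {a b : ℕ} {y z : G}

theorem pow_letter {n : ℕ} (hy : IsWeightedCommutator S a y) (hn : n * ε ^ a ≤ 1) :
    HasCost S ε a 1 (y ^ n) :=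
  ((of_isWeightedCommutator le_rfl hy).pow n).mono hn

theorem exists_commutator_pow_right (hε : 0 ≤ ε) (hε₁ : ε ≤ 1)
    (hy : IsWeightedCommutator S a y) (hz : IsWeightedCommutator S b z) (s : ℕ)
    (hs : s * ε ^ b ≤ 1) : ∃ v, ⁅y, z ^ s⁆ = v * ⁅y, z⁆ ^ s ∧
      HasCost S ε (a + b + 1) (s * ε ^ (a + b) * Real.exp 3) v := by
  have h0 : 0 ≤ ε ^ (a + b) := by positivity
  have hpow : ε ^ (a + b) ≤ 1 := pow_le_one₀ hε hε₁
  induction s with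
  | zero => exact ⟨1, by simp, one (by positivity)⟩
  | succ s ih =>
    have hs' : s * ε ^ b ≤ 1 := by
      push_cast at hs; linarith [(by positivity : 0 ≤ ε ^ b)]
    obtain ⟨v, hv, hvc⟩ := ih hs'
    have hx := hy.commutator hz
    have hsx : s * ε ^ (a + b) ≤ 1 := by
      calc s * ε ^ (a + b) = s * ε ^ b * ε ^ a := by rw [pow_add]; ring
        _ ≤ 1 * 1 := by gcongr; exact pow_le_one₀ hε hε₁
        _ = 1 := one_mul 1
    have hc := ((pow_letter hx hsx).conj hε ((pow_letter hz hs').commutator hε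
      (of_isWeightedCommutator le_rfl hx))).anti (by have := hz.one_le; omega : a + b + 1 ≤ _)
    refine ⟨v * (⁅y, z⁆ ^ s * ⁅z ^ s, ⁅y, z⁆⁆ * (⁅y, z⁆ ^ s)⁻¹), ?_, (hvc.mul hc).mono ?_⟩
    · have e : ⁅y, z ^ (s + 1)⁆ = ⁅y, z ^ s⁆ * (⁅z ^ s, ⁅y, z⁆⁆ * ⁅y, z⁆) := by
        simp only [commutatorElement_def]; group
      rw [e, hv, pow_succ]
      group
    · calc s * ε ^ (a + b) * Real.exp 3 +
            1 * ε ^ (a + b) * Real.exp (1 + ε ^ (a + b)) * Real.exp 1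
          ≤ s * ε ^ (a + b) * Real.exp 3 + 1 * ε ^ (a + b) * Real.exp (1 + 1) * Real.exp 1 := by
            gcongr
        _ = _ := by rw [mul_assoc (1 * ε ^ (a + b)), ← Real.exp_add]; push_cast; norm_num; ring

theorem exists_commutator_pow_left (hε : 0 ≤ ε) (hε₁ : ε ≤ 1) (ha : 1 ≤ a)
    (hy : IsWeightedCommutator S a y) (hz : IsWeightedCommutator S b z) (s q : ℕ)
    (hs : s * ε ^ b ≤ 1) (hq : q * ε ^ a ≤ 1) : ∃ v, ⁅y ^ q, z ^ s⁆ = ⁅y, z⁆ ^ (q * s) * v ∧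
      HasCost S ε (a + b + 1) (q * ε ^ a * (2 * Real.exp 5)) v := by
  have h0 : 0 ≤ ε ^ a := by positivity
  have hx := hy.commutator hz
  obtain ⟨v, hv, hvc⟩ := exists_commutator_pow_right hε hε₁ hy hz s hs
  have hsx : s * ε ^ (a + b) ≤ ε ^ a := by
    calc s * ε ^ (a + b) = s * ε ^ b * ε ^ a := by rw [pow_add]; ring
      _ ≤ 1 * ε ^ a := by gcongr
      _ = ε ^ a := one_mul _
  induction q with
  | zero => exact ⟨1, by simp, one (by simp)⟩
  | succ q ih =>
    have hq' : q * ε ^ a ≤ 1 := by push_cast at hq; linarith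
    obtain ⟨w, hw, hwc⟩ := ih hq'
    have hqs : ((q + 1) * s : ℕ) * ε ^ (a + b) ≤ 1 := by
      calc (((q + 1) * s : ℕ) : ℝ) * ε ^ (a + b) = (q + 1 : ℕ) * (s * ε ^ (a + b)) := by
            push_cast; ring
        _ ≤ (q + 1 : ℕ) * ε ^ a := by gcongr
        _ ≤ 1 := hq
    have hxs : HasCost S ε (a + b) (ε ^ a) (⁅y, z⁆ ^ s) :=
      ((of_isWeightedCommutator le_rfl hx).pow s).mono hsx
    have hyq := pow_letter hy hq'
    have hc := (pow_letter hx.inv hqs).conj hε ((hyq.conj hε hvc).mul ((hyq.commutator hε hxs).anti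
      (by omega : a + b + 1 ≤ a + (a + b))))
    refine ⟨_, ?_, (hc.mul hwc).mono ?_⟩
    · have e : ⁅y ^ (q + 1), z ^ s⁆ = y ^ q * ⁅y, z ^ s⁆ * (y ^ q)⁻¹ * ⁅y ^ q, z ^ s⁆ := by
        simp only [commutatorElement_def]; group
      rw [e, hw, hv, inv_pow, inv_inv, add_mul, one_mul, pow_add, commutatorElement_def (y ^ q)]
      group
    · have h1 : ε ^ a ≤ 1 := pow_le_one₀ hε hε₁
      calc (s * ε ^ (a + b) * Real.exp 3 * Real.exp 1 + 1 * ε ^ a * Real.exp (1 + ε ^ a))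
              * Real.exp 1 + q * ε ^ a * (2 * Real.exp 5)
          ≤ (ε ^ a * Real.exp 3 * Real.exp 1 + 1 * ε ^ a * Real.exp (1 + 3)) * Real.exp 1
              + q * ε ^ a * (2 * Real.exp 5) := by
            gcongr
            linarith
        _ = ε ^ a * (2 * (Real.exp 4 * Real.exp 1)) + q * ε ^ a * (2 * Real.exp 5) := by
            rw [mul_assoc (ε ^ a), ← Real.exp_add]; norm_num; ring
        _ = _ := by rw [← Real.exp_add]; push_cast; norm_num; ring

end HasCost

section Length

variable {G : Type} [Group G] {S : Set G} {n n' : ℕ} {g h : G}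

/-- `HasLength S n g` : `g` is a product of at most `n` elements of `S` and their inverses. -/
def HasLength (S : Set G) (n : ℕ) (g : G) : Prop :=
  ∃ L : List G, L.length ≤ n ∧ (∀ x ∈ L, x ∈ S ∨ x⁻¹ ∈ S) ∧ L.prod = g

namespace HasLength

theorem one : HasLength S n (1 : G) := ⟨[], by simp⟩

theorem mono (hn : n ≤ n') (hg : HasLength S n g) : HasLength S n' g := by
  obtain ⟨L, h, hL⟩ := hg
  exact ⟨L, h.trans hn, hL⟩

theorem mul (hg : HasLength S n g) (hh : HasLength S n' h) : HasLength S (n + n') (g * h) := by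
  obtain ⟨L, hn, hL, rfl⟩ := hg
  obtain ⟨L', hn', hL', rfl⟩ := hh
  refine ⟨L ++ L', by simpa using Nat.add_le_add hn hn', fun x hx => ?_, List.prod_append⟩
  exact (List.mem_append.1 hx).elim (hL x) (hL' x)

theorem inv (hg : HasLength S n g) : HasLength S n g⁻¹ := by
  obtain ⟨L, hn, hL, rfl⟩ := hg
  refine ⟨(L.map (·⁻¹)).reverse, by simpa using hn, fun x hx => ?_, (List.prod_inv_reverse L).symm⟩
  obtain ⟨y, hy, rfl⟩ := List.mem_map.1 (List.mem_reverse.1 hx)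
  simpa using (hL y hy).symm

theorem hasCost {ε : ℝ} (hg : HasLength S n g) (hε : 0 ≤ ε) : HasCost S ε 1 (n * ε) g := by
  obtain ⟨L, hn, hL, rfl⟩ := hg
  have := HasCost.list_prod (ε := ε) (i := 1) fun x hx => (hL x hx).elim (fun h => .of h)
    (fun h => by simpa using (IsWeightedCommutator.of h).inv)
  exact this.mono (by rw [pow_one]; gcongr)

end HasLength

variable {ι : Type} {m : ι → ℕ} {i j a b : ℕ}

/-- The families whose length is bounded by a multiple of the scale. -/
def lengthSubgroup (S : Set G) (m : ι → ℕ) : Subgroup (ι → G) where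
  carrier := {u | ∃ D, ∀ k, HasLength S (D * m k) (u k)}
  one_mem' := ⟨0, fun _ => .one⟩
  mul_mem' := by
    rintro u v ⟨D, hD⟩ ⟨D', hD'⟩
    exact ⟨D + D', fun k => by rw [add_mul]; exact (hD k).mul (hD' k)⟩
  inv_mem' := by
    rintro u ⟨D, hD⟩
    exact ⟨D, fun k => (hD k).inv⟩

/-- The families of bounded cost in weights at least `i`. -/
def costSubgroup (S : Set G) (m : ι → ℕ) (i : ℕ) : Subgroup (ι → G) where
  carrier := {u | ∃ κ, UniformCost S m i κ u}
  one_mem' := ⟨0, .one le_rfl⟩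
  mul_mem' := by
    rintro u v ⟨κ, hu⟩ ⟨κ', hv⟩
    exact ⟨κ + κ', hu.mul hv⟩
  inv_mem' := by
    rintro u ⟨κ, hu⟩
    exact ⟨κ, hu.inv⟩

theorem costSubgroup_anti (h : i ≤ j) : costSubgroup S m j ≤ costSubgroup S m i :=
  fun _ ⟨κ, hu⟩ => ⟨κ, hu.anti h⟩

theorem commutator_mem_costSubgroup {u v : ι → G} (hu : u ∈ costSubgroup S m i)
    (hv : v ∈ costSubgroup S m j) : ⁅u, v⁆ ∈ costSubgroup S m (i + j) := by
  obtain ⟨κ, hu⟩ := hu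
  obtain ⟨μ, hv⟩ := hv
  exact ⟨_, hu.commutator hv⟩

theorem lengthSubgroup_le (hm : ∀ k, 1 ≤ m k) : lengthSubgroup S m ≤ costSubgroup S m 1 := by
  rintro u ⟨D, hD⟩
  refine ⟨D, fun k => ((hD k).hasCost (by positivity)).mono ?_⟩
  have hk : (m k : ℝ) ≠ 0 := by exact_mod_cast Nat.one_le_iff_ne_zero.1 (hm k)
  push_cast
  rw [mul_inv_cancel_right₀ hk]

theorem costSubgroup_one_le_normalizer (i : ℕ) :
    costSubgroup S m 1 ≤ Subgroup.normalizer (costSubgroup S m i : Set (ι → G)) := by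
  rw [Subgroup.le_normalizer_iff]
  rintro u ⟨κ, hu⟩ v ⟨μ, hv⟩
  exact ⟨_, fun k => (hu k).conj (by positivity) (hv k)⟩

theorem mem_sup_costSubgroup_iff (hm : ∀ k, 1 ≤ m k) {u : ι → G} :
    u ∈ lengthSubgroup S m ⊔ costSubgroup S m i ↔
      ∃ h ∈ lengthSubgroup S m, ∃ v ∈ costSubgroup S m i, h * v = u := by
  rw [← SetLike.mem_coe, Subgroup.coe_mul_of_left_le_normalizer_right _ _
    ((lengthSubgroup_le hm).trans (costSubgroup_one_le_normalizer i)), Set.mem_mul]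
  rfl

theorem commutator_mem_sup (hm : ∀ k, 1 ≤ m k) {u v : ι → G}
    (hu : u ∈ costSubgroup S m a) (hu' : u ∈ lengthSubgroup S m ⊔ costSubgroup S m (a + 1))
    (hv : v ∈ costSubgroup S m b) (hv' : v ∈ lengthSubgroup S m ⊔ costSubgroup S m (b + 1)) :
    ⁅u, v⁆ ∈ lengthSubgroup S m ⊔ costSubgroup S m (a + b + 1) := by
  obtain ⟨h₁, hh₁, v₁, hv₁, rfl⟩ := (mem_sup_costSubgroup_iff hm).1 hu'
  obtain ⟨h₂, hh₂, v₂, hv₂, rfl⟩ := (mem_sup_costSubgroup_iff hm).1 hv'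
  have hc₁ : h₁ ∈ costSubgroup S m a :=
    (Subgroup.mul_mem_cancel_right _ (costSubgroup_anti (by omega) hv₁)).1 hu
  have e : ⁅h₁ * v₁, h₂ * v₂⁆ =
      h₁ * ⁅v₁, h₂ * v₂⁆ * h₁⁻¹ * (⁅h₁, h₂⁆ * (h₂ * ⁅h₁, v₂⁆ * h₂⁻¹)) := by
    simp only [commutatorElement_def]; group
  have conj : ∀ h ∈ lengthSubgroup S m, ∀ w ∈ costSubgroup S m (a + b + 1),
      h * w * h⁻¹ ∈ lengthSubgroup S m ⊔ costSubgroup S m (a + b + 1) := fun h hh w hw =>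
    mul_mem (mul_mem (Subgroup.mem_sup_left hh) (Subgroup.mem_sup_right hw))
      (inv_mem (Subgroup.mem_sup_left hh))
  rw [e]
  refine mul_mem (conj _ hh₁ _ ?_) (mul_mem (Subgroup.mem_sup_left ?_) (conj _ hh₂ _ ?_))
  · exact costSubgroup_anti (by omega) (commutator_mem_costSubgroup hv₁ hv)
  · rw [commutatorElement_def]
    exact mul_mem (mul_mem (mul_mem hh₁ hh₂) (inv_mem hh₁)) (inv_mem hh₂)
  · exact costSubgroup_anti (by omega) (commutator_mem_costSubgroup hc₁ hv₂)

theorem nat_mul_inv_pow_le_one {f m : ℕ} (hm : 1 ≤ m) (h : f ≤ m ^ i) :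
    (f : ℝ) * (m : ℝ)⁻¹ ^ i ≤ 1 := by
  exact_mod_cast mul_inv_pow_le (B := 1) hm (by simpa using h)

theorem pow_mem_sup (hm : ∀ k, 1 ≤ m k) {x : G} (hx : IsWeightedCommutator S i x) (f : ι → ℕ)
    (hf : ∀ k, f k ≤ m k ^ i) :
    (fun k => x ^ f k) ∈ lengthSubgroup S m ⊔ costSubgroup S m (i + 1) := by
  induction hx generalizing f with
  | @of s hs =>
    refine Subgroup.mem_sup_left ⟨1, fun k => ⟨List.replicate (f k) s, ?_, fun x hx => ?_, ?_⟩⟩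
    · simpa using hf k
    · exact Or.inl ((List.eq_of_mem_replicate hx) ▸ hs)
    · simp
  | inv _ ih =>
    convert inv_mem (ih f hf) using 1
    funext k
    simp [inv_pow]
  | @commutator a b y z hy hz ihy ihz =>
    have ha := hy.one_le
    have key : ∀ q s : ι → ℕ, (∀ k, q k ≤ m k ^ a) → (∀ k, s k ≤ m k ^ b) →
        (fun k => ⁅y, z⁆ ^ (q k * s k)) ∈ lengthSubgroup S m ⊔ costSubgroup S m (a + b + 1) := by
      intro q s hq hs
      have hq1 k := nat_mul_inv_pow_le_one (hm k) (hq k)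
      have hs1 k := nat_mul_inv_pow_le_one (hm k) (hs k)
      have hε k : (m k : ℝ)⁻¹ ≤ 1 := inv_le_one_of_one_le₀ (by exact_mod_cast hm k)
      choose v hv hvc using fun k =>
        HasCost.exists_commutator_pow_left (by positivity) (hε k) ha hy hz _ _ (hs1 k) (hq1 k)
      have hvm : v ∈ costSubgroup S m (a + b + 1) := ⟨1 * (2 * Real.exp 5), fun k =>
        (hvc k).mono (mul_le_mul_of_nonneg_right (hq1 k) (by positivity))⟩
      have hc := commutator_mem_sup hm (u := fun k => y ^ q k) (v := fun k => z ^ s k)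
        ⟨1, fun k => HasCost.pow_letter hy (hq1 k)⟩ (ihy q hq)
        ⟨1, fun k => HasCost.pow_letter hz (hs1 k)⟩ (ihz s hs)
      rw [← Subgroup.mul_mem_cancel_right _ (Subgroup.mem_sup_right hvm)]
      convert hc using 1
      exact funext fun k => (hv k).symm
    have h1 := key (fun k => f k / m k ^ b) (fun k => m k ^ b) (fun k => by
      rw [Nat.div_le_iff_le_mul_add_pred (Nat.pow_pos (hm k))]
      have := hf k
      rw [pow_add] at this
      rw [mul_comm]
      omega) (fun k => le_rfl)
    have h2 := key (fun _ => 1) (fun k => f k % m k ^ b) (fun k => Nat.one_le_pow _ _ (hm k))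
      (fun k => (Nat.mod_lt _ (Nat.pow_pos (hm k))).le)
    convert mul_mem h1 h2 using 1
    funext k
    rw [Pi.mul_apply, ← pow_add, one_mul, Nat.div_add_mod']

theorem pow_mem_sup_of_le_mul (hm : ∀ k, 1 ≤ m k) {x : G} (hx : IsWeightedCommutator S i x) (M : ℕ)
    (f : ι → ℕ) (hf : ∀ k, f k ≤ M * m k ^ i) :
    (fun k => x ^ f k) ∈ lengthSubgroup S m ⊔ costSubgroup S m (i + 1) := by
  induction M generalizing f with
  | zero =>
    convert one_mem (lengthSubgroup S m ⊔ costSubgroup S m (i + 1)) with k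
    have := hf k
    simp_all
  | succ M ih =>
    convert mul_mem (pow_mem_sup hm hx (fun k => min (f k) (m k ^ i)) fun k => min_le_right _ _)
      (ih (fun k => f k - min (f k) (m k ^ i)) fun k => ?_) using 1
    · funext k
      rw [Pi.mul_apply, ← pow_add]
      congr 1
      omega
    · have := hf k
      rw [add_mul] at this
      omega

theorem letterFamily_indicator [Fintype {x // IsWeightedCommutator S j x}]
    (x : {x // IsWeightedCommutator S j x}) (a : ι × {x // IsWeightedCommutator S j x} → ℕ)
    (ha : ∀ k y, y ≠ x → a (k, y) = 0) : letterFamily a = fun k => x.1 ^ a (k, x) := by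
  funext k
  rw [letterFamily, List.prod_eq_pow_card _ x.1, length_letterWord, Fintype.sum_eq_single x (ha k)]
  intro y hy
  rw [letterWord, Multiset.mem_toList, Multiset.mem_sum] at hy
  obtain ⟨z, -, hz⟩ := hy
  obtain rfl := Multiset.mem_singleton.1 (Multiset.mem_of_mem_nsmul hz)
  by_contra hne
  rw [ha k z fun h => hne (congr_arg _ h)] at hz
  simp at hz

theorem letterFamily_mem_lengthSubgroup [Fintype {x // IsWeightedCommutator S j x}] {B : ℕ}
    (hm : ∀ k, 1 ≤ m k) (hj : 1 ≤ j) (ih : costSubgroup S m (j + 1) ≤ lengthSubgroup S m)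
    {a : ι × {x // IsWeightedCommutator S j x} → ℕ} (ha : a ∈ smallExponents S m j B) :
    letterFamily a ∈ lengthSubgroup S m := by
  classical
  have H : ∀ s : Finset {x // IsWeightedCommutator S j x}, ∀ a ∈ smallExponents S m j B,
      (∀ k, ∀ y ∉ s, a (k, y) = 0) → letterFamily a ∈ lengthSubgroup S m := by
    intro s
    induction s using Finset.induction_on with
    | empty =>
      intro a _ hz
      convert one_mem (lengthSubgroup S m)
      funext k
      simp [letterFamily, letterWord, hz]
    | insert x s hx hs =>
      intro a ha hz
      have e : a = (fun p => if p.2 = x then a p else 0) + fun p => if p.2 = x then 0 else a p := by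
        ext p
        simp only [Pi.add_apply]
        split_ifs <;> simp
      rw [e] at ha
      obtain ⟨v, hv, hva⟩ := exists_letterFamily_add hm hj ha
      rw [e, hva]
      refine mul_mem (ih ⟨_, hv⟩) (mul_mem ?_ (hs _ ?_ ?_))
      · rw [letterFamily_indicator x _ fun k y hy => by simp [hy]]
        rw [← sup_eq_left.2 ih]
        refine pow_mem_sup_of_le_mul hm x.2 B _ fun k => ?_
        refine le_trans ?_ (ha k)
        refine le_trans ?_ (Finset.single_le_sum (fun _ _ => Nat.zero_le _) (Finset.mem_univ x))
        simp
      · exact isLowerSet_smallExponents (fun _ => Nat.le_add_left _ _) ha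
      · intro k y hy
        by_cases hyx : y = x
        · simp [hyx]
        · simpa [hyx] using hz k y (by simp [hyx, hy])
  exact H Finset.univ a ha (by simp)

theorem costSubgroup_le_lengthSubgroup [Group.IsNilpotent G] (hS : S.Finite) (hm : ∀ k, 1 ≤ m k)
    (hj : 1 ≤ j) : costSubgroup S m j ≤ lengthSubgroup S m := by
  obtain ⟨c, hc⟩ := IsWeightedCommutator.exists_eq_one S
  rcases le_total c j with hcj | hjc
  · rintro u ⟨κ, hu⟩
    obtain rfl : u = 1 := funext fun k => ((hu k).anti hcj).eq_one hc
    exact one_mem _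
  · induction hjc using Nat.decreasingInduction with
    | self =>
      rintro u ⟨κ, hu⟩
      obtain rfl : u = 1 := funext fun k => (hu k).eq_one hc
      exact one_mem _
    | of_succ j _ ih =>
      specialize ih (by omega)
      have : Fintype {x // IsWeightedCommutator S j x} :=
        (IsWeightedCommutator.finite hS j).fintype
      rintro u ⟨κ, hu⟩
      obtain ⟨B, hB⟩ := exists_nat_ge κ
      choose v e he hv hs using fun k => (hu k).exists_eq_mul_letterWord (by positivity) hj
      have ha : (fun p : ι × _ => e p.1 p.2) ∈ smallExponents S m j B := fun k => by
        have hk : (0 : ℝ) < m k := by exact_mod_cast hm k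
        have := (hs k).trans hB
        rw [inv_pow, ← div_eq_mul_inv, div_le_iff₀ (by positivity)] at this
        exact_mod_cast this
      obtain rfl : u = v * letterFamily (fun p : ι × _ => e p.1 p.2) := funext he
      exact mul_mem (ih ⟨_, hv⟩) (letterFamily_mem_lengthSubgroup hm hj ih ha)

theorem exists_hasLength_of_hasCost [Group.IsNilpotent G] (hS : S.Finite) (κ : ℝ) :
    ∃ D : ℕ, ∀ m : ℕ, 1 ≤ m → ∀ g, HasCost S (m : ℝ)⁻¹ 1 κ g → HasLength S (D * m) g := by
  let ι := {p : ℕ × G // 1 ≤ p.1 ∧ HasCost S (p.1 : ℝ)⁻¹ 1 κ p.2}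
  obtain ⟨D, hD⟩ := costSubgroup_le_lengthSubgroup (m := fun p : ι => p.1.1) hS (fun p => p.2.1)
    le_rfl (show (fun p : ι => p.1.2) ∈ _ from ⟨κ, fun p => p.2.2⟩)
  exact ⟨D, fun m hm g hg => hD ⟨(m, g), hm, hg⟩⟩

end Length

section Connected

variable {A : Type} {R : Set (Word A)} {ℓ ℓ' : ℕ} {u u' v v' w w' : Word A}

/-- `Move R w w'` : one of `w`, `w'` arises from the other by deleting a relator or a subword
`a a⁻¹`. -/
def Move (R : Set (Word A)) (w w' : Word A) : Prop :=
  ∃ α u β, (u ∈ R ∨ ∃ x : A × Bool, u = [x, (x.1, !x.2)]) ∧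
    (w = α ++ u ++ β ∧ w' = α ++ β ∨ w' = α ++ u ++ β ∧ w = α ++ β)

theorem Move.symm (h : Move R w w') : Move R w' w := by
  obtain ⟨α, u, β, hu, h⟩ := h
  exact ⟨α, u, β, hu, h.symm⟩

theorem Move.append (h : Move R w w') (u v : Word A) : Move R (u ++ w ++ v) (u ++ w' ++ v) := by
  obtain ⟨α, x, β, hx, h⟩ := h
  refine ⟨u ++ α, x, β ++ v, hx, ?_⟩
  rcases h with ⟨rfl, rfl⟩ | ⟨rfl, rfl⟩ <;> simp

theorem wordInv_wordInv (w : Word A) : wordInv (wordInv w) = w := by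
  simp [wordInv, Function.comp_def]

theorem length_wordInv (w : Word A) : (wordInv w).length = w.length := by simp [wordInv]

theorem mk_wordInv (w : Word A) : FreeGroup.mk (wordInv w) = (FreeGroup.mk w)⁻¹ := by
  rw [FreeGroup.inv_mk]
  rfl

theorem Move.relStep_or_freeStep (h : Move R w w') : RelStep R w w' ∨ FreeStep w w' := by
  obtain ⟨α, u, β, hu | ⟨x, rfl⟩, h⟩ := h
  · left
    rcases h with ⟨rfl, rfl⟩ | ⟨rfl, rfl⟩
    · exact ⟨α, u, [], β, rfl, by simp, u, hu, Or.inl ⟨[], u, rfl, by simp [wordInv]⟩⟩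
    · exact ⟨α, [], u, β, by simp, rfl, u, hu, Or.inr ⟨[], wordInv u, rfl, by simp⟩⟩
  · right
    rcases h with h | h
    · exact Or.inl ⟨α, β, x, h⟩
    · exact Or.inr ⟨α, β, x, h.symm⟩

/-- `Connected R ℓ w w'` : `w'` is reached from `w` by moves through words of length at most
`ℓ`. -/
def Connected (R : Set (Word A)) (ℓ : ℕ) : Word A → Word A → Prop :=
  Relation.ReflTransGen fun w w' => Move R w w' ∧ w.length ≤ ℓ ∧ w'.length ≤ ℓ

namespace Connected

theorem refl : Connected R ℓ w w := Relation.ReflTransGen.refl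

theorem symm (h : Connected R ℓ w w') : Connected R ℓ w' w := by
  have : Std.Symm fun w w' => Move R w w' ∧ w.length ≤ ℓ ∧ w'.length ≤ ℓ :=
    ⟨fun _ _ h => ⟨h.1.symm, h.2.2, h.2.1⟩⟩
  exact Relation.ReflTransGen.stdSymm.symm _ _ h

theorem trans (h : Connected R ℓ u v) (h' : Connected R ℓ v w) : Connected R ℓ u w :=
  Relation.ReflTransGen.trans h h'

theorem mono (hℓ : ℓ ≤ ℓ') (h : Connected R ℓ w w') : Connected R ℓ' w w' :=
  Relation.ReflTransGen.mono (fun _ _ h => ⟨h.1, h.2.1.trans hℓ, h.2.2.trans hℓ⟩) _ _ h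

theorem append (h : Connected R ℓ w w') (u v : Word A) :
    Connected R (ℓ + u.length + v.length) (u ++ w ++ v) (u ++ w' ++ v) :=
  Relation.ReflTransGen.lift (fun x => u ++ x ++ v) (fun _ _ h => ⟨h.1.append u v, by
    simp only [List.length_append]; omega, by simp only [List.length_append]; omega⟩) _ _ h

theorem append_congr (h : Connected R ℓ u u') (h' : Connected R ℓ v v') :
    Connected R (ℓ + u'.length + v.length) (u ++ v) (u' ++ v') := by
  have h₁ := h.append [] v
  have h₂ := h'.append u' []
  simp only [List.nil_append, List.append_nil] at h₁ h₂
  exact (h₁.mono (by simp only [List.length_nil]; omega)).trans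
    (h₂.mono (by simp only [List.length_nil]; omega))

theorem of_move (h : Move R w w') (hw : w.length ≤ ℓ) (hw' : w'.length ≤ ℓ) : Connected R ℓ w w' :=
  Relation.ReflTransGen.single ⟨h, hw, hw'⟩

theorem append_wordInv (w : Word A) : Connected R (2 * w.length) (w ++ wordInv w) [] := by
  induction w with
  | nil => exact refl
  | cons x w ih =>
    have h := ih.append [x] [(x.1, !x.2)]
    have e : x :: w ++ wordInv (x :: w) = [x] ++ (w ++ wordInv w) ++ [(x.1, !x.2)] := by
      simp [wordInv]
    rw [e]
    refine (h.mono (by simp only [List.length_cons, List.length_nil]; omega)).trans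
      (of_move ⟨[], [x, (x.1, !x.2)], [], Or.inr ⟨x, rfl⟩, Or.inl (by simp)⟩ ?_ ?_) <;>
    simp only [List.length_cons, List.length_nil, List.length_append] <;> omega

theorem wordInv_append (w : Word A) : Connected R (2 * w.length) (wordInv w ++ w) [] := by
  simpa [wordInv_wordInv, length_wordInv] using append_wordInv (R := R) (wordInv w)

theorem map_eq {G : Type} [Group G] {π : FreeGroup A →* G} (hR : ∀ r ∈ R, π (FreeGroup.mk r) = 1)
    (h : Connected R ℓ w w') : π (FreeGroup.mk w) = π (FreeGroup.mk w') := by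
  induction h with
  | refl => rfl
  | tail _ h ih =>
    rw [ih]
    obtain ⟨⟨α, u, β, hu, h⟩, -⟩ := h
    have hu1 : π (FreeGroup.mk u) = 1 := by
      rcases hu with hu | ⟨x, rfl⟩
      · exact hR u hu
      · rw [show [x, (x.1, !x.2)] = [x] ++ wordInv [x] by simp [wordInv], ← FreeGroup.mul_mk,
          mk_wordInv, mul_inv_cancel, map_one]
    rcases h with ⟨rfl, rfl⟩ | ⟨rfl, rfl⟩ <;> simp [← FreeGroup.mul_mk, hu1]

theorem of_map_eq {G : Type} [Group G] {π : FreeGroup A →* G} {N : ℕ}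
    (hN : ∀ v : Word A, v.length ≤ N → π (FreeGroup.mk v) = 1 → Connected R ℓ v [])
    (hw : w.length + w'.length ≤ N) (h : π (FreeGroup.mk w) = π (FreeGroup.mk w')) :
    Connected R (ℓ + 2 * N) w w' := by
  have h₁ := ((wordInv_append (R := R) w').append w []).symm
  have h₂ := (hN (w ++ wordInv w') (by rwa [List.length_append, length_wordInv])
    (by rw [← FreeGroup.mul_mk, mk_wordInv, map_mul, map_inv, h, mul_inv_cancel])).append [] w'
  simp only [List.nil_append, List.append_nil, List.length_nil, ← List.append_assoc] at h₁ h₂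
  exact (h₁.mono (by omega)).trans (h₂.mono (by omega))

theorem exists_pSeq (h : Connected R ℓ w []) : ∃ S : PSeq R, IsNullSeq S w ∧ S.fl ≤ ℓ := by
  induction h using Relation.ReflTransGen.head_induction_on with
  | refl => exact ⟨⟨0, fun _ => [], fun _ => true, fun i => i.elim0⟩, ⟨rfl, rfl⟩, by simp [PSeq.fl]⟩
  | @head w w' h _ ih =>
    classical
    obtain ⟨S, hS, hfl⟩ := ih
    refine ⟨⟨S.len + 1, Fin.cons w S.seq, Fin.cons (decide (RelStep R w w')) S.isRel,
      fun i => ?_⟩, ⟨?_, ?_⟩, ?_⟩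
    · induction i using Fin.cases with
      | zero =>
        have := h.1.relStep_or_freeStep
        have e : Fin.cons (α := fun _ => Word A) w S.seq (Fin.succ 0) = w' := by
          rw [Fin.cons_succ, hS.1]
        rw [e]
        by_cases hrel : RelStep R w w'
        · simp [hrel]
        · simpa [hrel] using this
      | succ i =>
        have := S.step i
        simpa [← Fin.succ_castSucc] using this
    · rfl
    · rw [← Fin.succ_last]
      simpa using hS.2
    · refine Finset.sup_le fun i _ => ?_
      induction i using Fin.cases with
      | zero => exact h.2.1
      | succ i => exact (Finset.le_sup (f := fun i => (S.seq i).length) (Finset.mem_univ i)).trans hfl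

end Connected

end Connected

section Length

variable {A G : Type} [Group G] {π : FreeGroup A →* G}

theorem hasLength_map_mk (w : Word A) :
    HasLength (Set.range fun a => π (FreeGroup.of a)) w.length (π (FreeGroup.mk w)) := by
  induction w with
  | nil => exact ⟨[], le_rfl, by simp, (map_one π).symm⟩
  | cons x w ih =>
    have e : FreeGroup.mk (x :: w) = FreeGroup.mk [x] * FreeGroup.mk w := by
      rw [FreeGroup.mul_mk, List.singleton_append]
    rw [e, map_mul, List.length_cons, add_comm]
    refine HasLength.mul ⟨[π (FreeGroup.mk [x])], by simp, ?_, by simp⟩ ih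
    obtain ⟨a, _ | _⟩ := x
    · simp only [List.mem_singleton, forall_eq]
      exact Or.inr ⟨a, by rw [← map_inv]; rfl⟩
    · simp only [List.mem_singleton, forall_eq]
      exact Or.inl ⟨a, rfl⟩

theorem HasLength.exists_word {n : ℕ} {g : G}
    (hg : HasLength (Set.range fun a => π (FreeGroup.of a)) n g) :
    ∃ w : Word A, w.length ≤ n ∧ π (FreeGroup.mk w) = g := by
  obtain ⟨L, hn, hL, rfl⟩ := hg
  suffices H : ∃ w : Word A, w.length = L.length ∧ π (FreeGroup.mk w) = L.prod by
    obtain ⟨w, hw, h⟩ := H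
    exact ⟨w, hw.trans_le hn, h⟩
  clear hn
  induction L with
  | nil => exact ⟨[], rfl, map_one π⟩
  | cons y L ih =>
    obtain ⟨w, hw, h⟩ := ih fun x hx => hL x (by simp [hx])
    have H : ∃ x : A × Bool, π (FreeGroup.mk [x]) = y := by
      rcases hL y (by simp) with ⟨a, ha⟩ | ⟨a, ha⟩
      · exact ⟨(a, true), ha⟩
      · refine ⟨(a, false), ?_⟩
        rw [← inv_inv y, ← ha, ← map_inv]
        rfl
    obtain ⟨x, rfl⟩ := H
    refine ⟨x :: w, by simp [hw], ?_⟩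
    rw [List.prod_cons, ← h, ← map_mul, FreeGroup.mul_mk]
    rfl

end Length

section ConnectedGroup

variable {A ι : Type} {R : Set (Word A)} {m ℓ : ι → ℕ}

/-- The words `w k` have length bounded by a multiple of the scale `m k`. -/
def IsLinear (m : ι → ℕ) (w : ι → Word A) : Prop := ∃ K, ∀ k, (w k).length ≤ K * m k

theorem IsLinear.nil : IsLinear m fun _ => ([] : Word A) := ⟨0, by simp⟩

theorem IsLinear.append {u v : ι → Word A} (hu : IsLinear m u) (hv : IsLinear m v) :
    IsLinear m fun k => u k ++ v k := by
  obtain ⟨K, hu⟩ := hu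
  obtain ⟨K', hv⟩ := hv
  refine ⟨K + K', fun k => ?_⟩
  rw [List.length_append, add_mul]
  exact Nat.add_le_add (hu k) (hv k)

theorem IsLinear.wordInv {u : ι → Word A} (hu : IsLinear m u) :
    IsLinear m fun k => wordInv (u k) := by
  simpa only [IsLinear, length_wordInv] using hu

/-- The monoid of families of words of linear length. -/
def linearWords (A : Type) (m : ι → ℕ) : Submonoid (ι → FreeMonoid (A × Bool)) where
  carrier := {w | IsLinear m fun k => (w k).toList}
  one_mem' := IsLinear.nil
  mul_mem' hu hv := IsLinear.append hu hv

/-- The congruence relating families of words that are connected through words of length at most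
`ℓ` plus a multiple of the scale. -/
def connectedCon (R : Set (Word A)) (m ℓ : ι → ℕ) : Con (linearWords A m) where
  r u v := ∃ K, ∀ k, Connected R (ℓ k + K * m k) (u.1 k).toList (v.1 k).toList
  iseqv := by
    refine ⟨fun u => ⟨0, fun k => .refl⟩, ?_, ?_⟩
    · rintro u v ⟨K, h⟩
      exact ⟨K, fun k => (h k).symm⟩
    · rintro u v w ⟨K, h⟩ ⟨K', h'⟩
      refine ⟨K + K', fun k => ((h k).mono ?_).trans ((h' k).mono ?_)⟩ <;> rw [add_mul] <;> omega
  mul' := by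
    rintro ⟨u, hu⟩ ⟨u', K₁, hu'⟩ ⟨v, K₂, hv⟩ ⟨v', hv'⟩ ⟨K, h⟩ ⟨K', h'⟩
    refine ⟨K + K' + K₁ + K₂, fun k => ?_⟩
    refine (((h k).mono ?_).append_congr ((h' k).mono ?_)).mono (ℓ := ℓ k + (K + K') * m k +
      (u' k).toList.length + (v k).toList.length) ?_
    · rw [add_mul]; omega
    · rw [add_mul]; omega
    · have h₁ := hu' k
      have h₂ := hv k
      simp only at h₁ h₂
      simp only [add_mul]
      omega

/-- Families of words of linear length up to connectedness. -/
abbrev ConnectedGroup (R : Set (Word A)) (m ℓ : ι → ℕ) := (connectedCon R m ℓ).Quotient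

namespace ConnectedGroup

/-- The class of a family of words. -/
def mk (R : Set (Word A)) (ℓ : ι → ℕ) (w : ι → Word A) (hw : IsLinear m w) : ConnectedGroup R m ℓ :=
  ((⟨w, hw⟩ : linearWords A m) : (connectedCon R m ℓ).Quotient)

variable {u v : ι → Word A} {hu : IsLinear m u} {hv : IsLinear m v}

theorem mk_eq_mk_iff :
    mk R ℓ u hu = mk R ℓ v hv ↔ ∃ K, ∀ k, Connected R (ℓ k + K * m k) (u k) (v k) :=
  Con.eq _

theorem mk_mul_mk : mk R ℓ u hu * mk R ℓ v hv = mk R ℓ (fun k => u k ++ v k) (hu.append hv) :=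
  rfl

theorem mk_nil : mk R ℓ (fun _ => []) .nil = (1 : ConnectedGroup R m ℓ) := rfl

theorem exists_mk (p : ConnectedGroup R m ℓ) : ∃ w hw, mk R ℓ w hw = p := by
  induction p using Con.induction_on with
  | H w => exact ⟨w.1, w.2, rfl⟩

theorem mk_mul_mk_wordInv :
    mk R ℓ u hu * mk R ℓ (fun k => wordInv (u k)) hu.wordInv = 1 := by
  obtain ⟨K, hK⟩ := id hu
  rw [mk_mul_mk, ← mk_nil, mk_eq_mk_iff]
  refine ⟨2 * K, fun k => (Connected.append_wordInv (u k)).mono ?_⟩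
  have := hK k
  rw [mul_assoc]
  omega

theorem mk_wordInv_mul_mk :
    mk R ℓ (fun k => wordInv (u k)) hu.wordInv * mk R ℓ u hu = 1 := by
  obtain ⟨K, hK⟩ := id hu
  rw [mk_mul_mk, ← mk_nil, mk_eq_mk_iff]
  refine ⟨2 * K, fun k => (Connected.wordInv_append (u k)).mono ?_⟩
  have := hK k
  rw [mul_assoc]
  omega

noncomputable instance : Group (ConnectedGroup R m ℓ) := groupOfIsUnit fun p => by
  obtain ⟨u, hu, rfl⟩ := exists_mk p
  exact ⟨⟨_, _, mk_mul_mk_wordInv, mk_wordInv_mul_mk⟩, rfl⟩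

variable {G : Type} [Group G] {π : FreeGroup A →* G}

/-- The family of elements represented by a family of words. -/
def eval (hR : ∀ r ∈ R, π (FreeGroup.mk r) = 1) : ConnectedGroup R m ℓ →* (ι → G) :=
  (connectedCon R m ℓ).lift
    { toFun := fun w k => π (FreeGroup.mk (w.1 k).toList)
      map_one' := funext fun _ => map_one π
      map_mul' := fun u v => funext fun k =>
        map_mul π (FreeGroup.mk (u.1 k).toList) (FreeGroup.mk (v.1 k).toList) }
    (by
      rintro u v ⟨K, h⟩
      exact funext fun k => (h k).map_eq hR)

theorem eval_mk (hR : ∀ r ∈ R, π (FreeGroup.mk r) = 1) :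
    eval hR (mk R ℓ u hu) = fun k => π (FreeGroup.mk (u k)) := rfl

end ConnectedGroup

theorem Connected.exists_of_map_eq_one {G : Type} [Group G] {π : FreeGroup A →* G}
    (hker : π.ker = Subgroup.normalClosure (FreeGroup.mk '' R)) {w : Word A}
    (hw : π (FreeGroup.mk w) = 1) : ∃ ℓ, Connected R ℓ w [] := by
  have hlin (w : Word A) : IsLinear (fun _ : Unit => 1) fun _ => w := ⟨w.length, by simp⟩
  let cls (w : Word A) : ConnectedGroup R (fun _ : Unit => 1) (fun _ => 0) :=
    .mk R _ (fun _ => w) (hlin w)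
  let φ : FreeGroup A →* ConnectedGroup R (fun _ : Unit => 1) (fun _ => 0) :=
    FreeGroup.lift fun a => cls [(a, true)]
  have hφ (w : Word A) : φ (FreeGroup.mk w) = cls w := by
    induction w with
    | nil => exact map_one φ
    | cons x w ih =>
      have e : FreeGroup.mk (x :: w) = FreeGroup.mk [x] * FreeGroup.mk w := by
        rw [FreeGroup.mul_mk, List.singleton_append]
      have hx : φ (FreeGroup.mk [x]) = cls [x] := by
        obtain ⟨a, _ | _⟩ := x
        · have h : cls [(a, false)] * cls [(a, true)] = 1 :=
            ConnectedGroup.mk_wordInv_mul_mk (hu := hlin [(a, true)])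
          rw [eq_inv_of_mul_eq_one_left h]
          simp [φ]
        · simp [φ]
      rw [e, map_mul, ih, hx]
      exact ConnectedGroup.mk_mul_mk
  have hle : π.ker ≤ φ.ker := by
    rw [hker]
    refine Subgroup.normalClosure_le_normal ?_
    rintro _ ⟨r, hr, rfl⟩
    have h : cls r = cls [] := ConnectedGroup.mk_eq_mk_iff.2 ⟨r.length, fun _ =>
      .of_move ⟨[], r, [], Or.inl hr, Or.inl (by simp)⟩ (by simp) (by simp)⟩
    exact (hφ r).trans h
  have hw' : cls w = cls [] := (hφ w).symm.trans (hle hw)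
  obtain ⟨K, hK⟩ := ConnectedGroup.mk_eq_mk_iff.1 hw'
  exact ⟨_, hK ()⟩

theorem ConnectedGroup.exists_localSection {G : Type} [Group G] {π : FreeGroup A →* G}
    (hR : ∀ r ∈ R, π (FreeGroup.mk r) = 1) {κ : ℝ} {D : ℕ} (hD : 1 ≤ D) (hm : ∀ k, 1 ≤ m k)
    (hlen : ∀ m : ℕ, 1 ≤ m → ∀ g, HasCost (Set.range fun a => π (FreeGroup.of a)) (m : ℝ)⁻¹ 1 κ g →
      HasLength (Set.range fun a => π (FreeGroup.of a)) (D * m) g)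
    (hnull : ∀ k (v : Word A), v.length ≤ 3 * D * m k → π (FreeGroup.mk v) = 1 →
      Connected R (ℓ k) v []) :
    ∃ L : LocalSection (Set.range fun a => π (FreeGroup.of a)) m κ (ConnectedGroup R m ℓ),
      L.ev = eval hR := by
  have hrep : ∀ k g, ∃ w : Word A, w.length ≤ D * m k ∧
      (HasLength (Set.range fun a => π (FreeGroup.of a)) (D * m k) g →
        π (FreeGroup.mk w) = g) := by
    intro k g
    by_cases h : HasLength (Set.range fun a => π (FreeGroup.of a)) (D * m k) g
    · obtain ⟨w, hw, hg⟩ := h.exists_word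
      exact ⟨w, hw, fun _ => hg⟩
    · exact ⟨[], by simp, fun h' => absurd h' h⟩
  choose rep hrep_len hrep_map using hrep
  have hrep_lin (u : ι → G) : IsLinear m fun k => rep k (u k) := ⟨D, fun k => hrep_len k _⟩
  have hmk : ∀ {u v : ι → Word A} (hu : IsLinear m u) (hv : IsLinear m v),
      (∀ k, (u k).length + (v k).length ≤ 3 * D * m k) →
      (∀ k, π (FreeGroup.mk (u k)) = π (FreeGroup.mk (v k))) →
      mk R ℓ u hu = mk R ℓ v hv := fun hu hv hlen h => mk_eq_mk_iff.2
    ⟨2 * (3 * D), fun k => by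
      rw [mul_assoc]
      exact .of_map_eq (hnull k) (hlen k) (h k)⟩
  refine ⟨⟨eval hR, fun u => mk R ℓ (fun k => rep k (u k)) (hrep_lin u), ?_, ?_, ?_⟩,
    rfl⟩
  · intro u hu
    exact funext fun k => hrep_map k _ (hlen _ (hm k) _ (hu k))
  · intro u v hu hv huv
    rw [mk_mul_mk]
    refine hmk _ _ (fun k => ?_) fun k => ?_
    · have h₁ := hrep_len k (u k)
      have h₂ := hrep_len k (v k)
      have h₃ := hrep_len k ((u * v) k)
      rw [List.length_append, mul_assoc]
      omega
    · rw [← FreeGroup.mul_mk, map_mul, hrep_map k _ (hlen _ (hm k) _ (hu k)),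
        hrep_map k _ (hlen _ (hm k) _ (hv k)), hrep_map k _ (hlen _ (hm k) _ (huv k)),
        Pi.mul_apply]
  · rw [eq_top_iff]
    rintro p -
    obtain ⟨w, hw, rfl⟩ := exists_mk p
    obtain ⟨M, hM⟩ := id hw
    induction M generalizing w with
    | zero =>
      have : w = fun _ => [] := funext fun k => by simpa using hM k
      subst this
      exact one_mem _
    | succ M ih =>
      have hdrop (k : ι) : ((w k).drop (m k)).length ≤ M * m k := by
        have := hM k
        rw [add_mul] at this
        rw [List.length_drop]
        omega
      have htake (k : ι) : ((w k).take (m k)).length ≤ 1 * m k := by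
        rw [List.length_take]
        omega
      have hdrop' : IsLinear m fun k => (w k).drop (m k) := ⟨M, hdrop⟩
      have htake' : IsLinear m fun k => (w k).take (m k) := ⟨1, htake⟩
      have e : mk R ℓ w hw = mk R ℓ _ htake' * mk R ℓ _ hdrop' := by
        simp only [mk_mul_mk, List.take_append_drop]
      rw [e]
      refine mul_mem (Subgroup.subset_closure
        ⟨fun k => π (FreeGroup.mk ((w k).take (m k))), fun k => ?_, ?_⟩) (ih _ hdrop' hdrop)
      · have h := hasLength_map_mk (π := π) ((w k).take (m k))
        refine ((h.mono ((htake k).trans_eq (one_mul _))).hasCost (by positivity)).mono ?_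
        exact mul_inv_le_one
      · refine hmk _ _ (fun k => ?_) fun k => hrep_map k _ ((hasLength_map_mk _).mono ?_)
        · have h₁ := hrep_len k (π (FreeGroup.mk ((w k).take (m k))))
          have h₂ := htake k
          have h₃ := Nat.mul_le_mul_right (m k) hD
          simp only [mul_assoc, one_mul] at h₁ h₂ h₃ ⊢
          omega
        · exact (htake k).trans (Nat.mul_le_mul_right _ hD)

end ConnectedGroup

section FillingLength

variable {A G : Type} [Finite A] [Group G] [Group.IsNilpotent G] {R : Set (Word A)}
  {π : FreeGroup A →* G}

theorem exists_connected_of_half (hR : ∀ r ∈ R, π (FreeGroup.mk r) = 1) :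
    ∃ D K : ℕ, 1 ≤ D ∧ ∀ n, D ≤ n → ∀ ℓ,
      (∀ v : Word A, v.length ≤ n / 2 → π (FreeGroup.mk v) = 1 → Connected R ℓ v []) →
      ∀ w : Word A, w.length ≤ n → π (FreeGroup.mk w) = 1 → Connected R (ℓ + K * n) w [] := by
  have hS : (Set.range fun a => π (FreeGroup.of a)).Finite := Set.finite_range _
  obtain ⟨κ, hκ⟩ := exists_bound_injective_ev hS
  obtain ⟨D, hD⟩ := exists_hasLength_of_hasCost hS κ
  let ι := {p : ℕ × ℕ × Word A // 6 * (D + 1) ≤ p.1 ∧ p.2.2.length ≤ p.1 ∧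
    π (FreeGroup.mk p.2.2) = 1 ∧
    ∀ v : Word A, v.length ≤ p.1 / 2 → π (FreeGroup.mk v) = 1 → Connected R p.2.1 v []}
  let m (k : ι) : ℕ := k.1.1 / (6 * (D + 1))
  have hm (k : ι) : 1 ≤ m k := (Nat.one_le_div_iff (by omega)).2 k.2.1
  have hmul (k : ι) : 6 * (D + 1) * m k ≤ k.1.1 := Nat.mul_div_le _ _
  obtain ⟨L, hL⟩ := ConnectedGroup.exists_localSection (m := m) (ℓ := fun k => k.1.2.1) hR
    (by omega : 1 ≤ D + 1) hm
    (fun m hm g hg => (hD m hm g hg).mono (Nat.mul_le_mul_right m (Nat.le_succ D)))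
    (fun k v hv => k.2.2.2.2 v (hv.trans (by
      have := hmul k
      rw [Nat.le_div_iff_mul_le two_pos]
      linarith)))
  have hlin : IsLinear m fun k => k.1.2.2 := by
    refine ⟨2 * (6 * (D + 1)), fun k => k.2.2.1.trans ?_⟩
    have h₁ := Nat.lt_mul_div_succ k.1.1 (by omega : 0 < 6 * (D + 1))
    have h₂ := Nat.mul_le_mul_left (6 * (D + 1)) (hm k)
    simp only [m] at h₂ ⊢
    linarith
  have h := hκ L hm le_rfl (.mk R _ (fun k => k.1.2.2) hlin) (by
    rw [hL, ConnectedGroup.eval_mk]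
    exact funext fun k => k.2.2.2.1)
  obtain ⟨K, hK⟩ := ConnectedGroup.mk_eq_mk_iff.1 h
  refine ⟨6 * (D + 1), K, by omega, fun n hn ℓ hv w hw hw1 =>
    (hK ⟨(n, ℓ, w), hn, hw, hw1, hv⟩).mono ?_⟩
  exact Nat.add_le_add_left (Nat.mul_le_mul_left K (Nat.div_le_self _ _)) _

theorem exists_connected_linear
    (hker : π.ker = Subgroup.normalClosure (FreeGroup.mk '' R)) :
    ∃ ℓ K : ℕ, ∀ n, ∀ w : Word A, w.length ≤ n → π (FreeGroup.mk w) = 1 →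
      Connected R (ℓ + K * n) w [] := by
  have hR : ∀ r ∈ R, π (FreeGroup.mk r) = 1 := fun r hr => by
    rw [← MonoidHom.mem_ker, hker]
    exact Subgroup.subset_normalClosure ⟨r, hr, rfl⟩
  obtain ⟨D, K, hD, hK⟩ := exists_connected_of_half hR
  have hfin : {w : Word A | w.length ≤ D}.Finite := List.finite_length_le _ _
  choose! c hc using fun w => Connected.exists_of_map_eq_one (w := w) hker
  refine ⟨hfin.toFinset.sup c, 2 * K, fun n => ?_⟩
  induction n using Nat.strong_induction_on with
  | _ n ih =>
    intro w hw hw1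
    rcases le_total n D with hn | hn
    · refine (hc w hw1).mono ((Finset.le_sup ?_).trans (Nat.le_add_right _ _))
      simpa using hw.trans hn
    · refine (hK n hn _ (ih (n / 2) (by omega)) w hw hw1).mono ?_
      have := Nat.mul_le_mul_left K (Nat.mul_div_le n 2)
      linarith

end FillingLength

/-- **Corollary.**  If `⟨A ∣ R⟩` is a finite presentation of a (finitely generated)
nilpotent group `G` then there is `λ > 0` such that the filling length function
satisfies `FL(n) ≤ λ·n` for all `n`: every null-homotopic word `w` with `ℓ(w) ≤ n`
admits a null-`P`-sequence `S` with `FL(S) ≤ λ·n`. -/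
theorem filling_length_linear_nilpotent
    {A : Type} [Fintype A] {G : Type} [Group G]
    (hnilp : Group.IsNilpotent G)
    (R : Finset (Word A)) (π : FreeGroup A →* G)
    (hsurj : Function.Surjective π)
    (hker : π.ker = Subgroup.normalClosure (FreeGroup.mk '' (R : Set (Word A)))) :
    ∃ lam : ℝ, 0 < lam ∧ ∀ (n : ℕ) (w : Word A), w.length ≤ n →
      π (FreeGroup.mk w) = 1 →
      ∃ S : PSeq (R : Set (Word A)), IsNullSeq S w ∧ (S.fl : ℝ) ≤ lam * (n : ℝ) := by
  obtain ⟨ℓ, K, h⟩ := exists_connected_linear hker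
  refine ⟨ℓ + K + 1, by positivity, fun n w hw hw1 => ?_⟩
  rcases n.eq_zero_or_pos with rfl | hn
  · obtain rfl := List.eq_nil_of_length_eq_zero (Nat.le_zero.1 hw)
    obtain ⟨S, hS, hfl⟩ := (Connected.refl (R := (R : Set (Word A))) (ℓ := 0)).exists_pSeq
    exact ⟨S, hS, by simpa using hfl⟩
  · obtain ⟨S, hS, hfl⟩ := (h n w hw hw1).exists_pSeq
    refine ⟨S, hS, ?_⟩
    have h₁ : (S.fl : ℝ) ≤ ℓ + K * n := by exact_mod_cast hfl
    have h₂ : (1 : ℝ) ≤ n := by exact_mod_cast hn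
    have h₃ : (0 : ℝ) ≤ ℓ := by positivity
    nlinarith
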